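/- Let X be a compact Ptolemy space with properties (E) and (I), and suppose that for some ω ∈ X every fiber of the canonical fibration π_ω is a single point (the case p = 0). Then there exist an integer n ≥ 1 and a metric d ∈ 𝓜 with infinitely remote point ω such that (X∖{ω}, d) is isometric to the Euclidean space ℝⁿ; consequently X is Möbius equivalent to the standard Möbius sphere, the one-point extension of ℝⁿ, which is the boundary at infinity of the real hyperbolic space H^{n+1}. -/

import Mathlib

open scoped ENNReal

namespace Mobius

/-- An extended metric on `X`, allowed to have (at most) one infinitely remote point,
which is recorded in the field `rem`.  Distances take values in `ℝ≥0∞`, and the value `⊤`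
occurs exactly on pairs of distinct points one of which is the remote point. -/
structure ExtMetric (X : Type*) where
  d : X → X → ℝ≥0∞
  rem : Option X
  symm : ∀ x y, d x y = d y x
  d_self : ∀ x, d x x = 0
  pos : ∀ x y, x ≠ y → 0 < d x y
  triangle : ∀ x y z, d x z ≤ d x y + d y z
  d_eq_top_iff : ∀ x y, d x y = ⊤ ↔ (x ≠ y ∧ (rem = some x ∨ rem = some y))

/-- The finite factor of a distance used in cross-ratio triples: infinite factors are
dropped (replaced by `1`), in accordance with the standard conventions for cross-ratio
triples of quadruples containing the infinitely remote point. -/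
noncomputable def ExtMetric.fd {X : Type*} (d : ExtMetric X) (x y : X) : ℝ :=
  if d.d x y = ⊤ then 1 else (d.d x y).toReal

/-- A representative in `ℝ³` of the cross-ratio triple
`crt(x,y,z,u) = (d(x,y)d(z,u) : d(x,z)d(y,u) : d(x,u)d(y,z)) ∈ ℝP²`,
with the standard conventions when the infinitely remote point occurs among the points. -/
noncomputable def crtVec {X : Type*} (d : ExtMetric X) (x y z u : X) : ℝ × ℝ × ℝ :=
  (d.fd x y * d.fd z u, d.fd x z * d.fd y u, d.fd x u * d.fd y z)

/-- A quadruple is admissible if no entry occurs three or four times in it. -/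
def Admissible {X : Type*} (x y z u : X) : Prop :=
  ¬(x = y ∧ y = z) ∧ ¬(x = y ∧ y = u) ∧ ¬(x = z ∧ z = u) ∧ ¬(y = z ∧ z = u)

/-- Two vectors in `ℝ³` represent the same point of the projective plane (they are
positively proportional). -/
def ProjEq (v w : ℝ × ℝ × ℝ) : Prop :=
  ∃ lam : ℝ, 0 < lam ∧ w = lam • v

theorem ProjEq.refl (v : ℝ × ℝ × ℝ) : ProjEq v v :=
  ⟨1, one_pos, (one_smul ℝ v).symm⟩

theorem ProjEq.symm {v w : ℝ × ℝ × ℝ} (h : ProjEq v w) : ProjEq w v := by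
  obtain ⟨l, hl, rfl⟩ := h
  exact ⟨l⁻¹, inv_pos.mpr hl, by rw [smul_smul, inv_mul_cancel₀ hl.ne', one_smul]⟩

theorem ProjEq.trans' {v w u : ℝ × ℝ × ℝ} (h1 : ProjEq v w) (h2 : ProjEq v u) :
    ProjEq w u := by
  obtain ⟨l, hl, rfl⟩ := h1
  obtain ⟨m, hm, rfl⟩ := h2
  refine ⟨m * l⁻¹, by positivity, ?_⟩
  rw [smul_smul, mul_assoc, inv_mul_cancel₀ hl.ne', mul_one]

/-- A Möbius structure on a set `X`: a (maximal) class of pairwise Möbius-equivalent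
extended metrics on `X`, i.e. metrics defining the same cross-ratio triples on all
admissible quadruples. -/
structure MobiusStructure (X : Type*) where
  M : Set (ExtMetric X)
  nonempty : M.Nonempty
  compat : ∀ d ∈ M, ∀ d' ∈ M, ∀ x y z u : X, Admissible x y z u →
    ProjEq (crtVec d x y z u) (crtVec d' x y z u)
  maximal : ∀ d' : ExtMetric X,
    (∀ d ∈ M, ∀ x y z u : X, Admissible x y z u →
      ProjEq (crtVec d x y z u) (crtVec d' x y z u)) → d' ∈ M

/-- The Möbius structure generated by a single extended metric. -/
def MobiusStructure.ofMetric {X : Type*} (d₀ : ExtMetric X) : MobiusStructure X where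
  M := {d | ∀ x y z u : X, Admissible x y z u →
    ProjEq (crtVec d₀ x y z u) (crtVec d x y z u)}
  nonempty := ⟨d₀, fun _ _ _ _ _ => ProjEq.refl _⟩
  compat := fun _ hd _ hd' x y z u ha => (hd x y z u ha).trans' (hd' x y z u ha)
  maximal := fun _ h => h d₀ (fun _ _ _ _ _ => ProjEq.refl _)

/-- A Möbius structure is Ptolemy if the entries of every cross-ratio triple of every
admissible quadruple satisfy the triangle inequality. -/
def IsPtolemyStructure {X : Type*} (S : MobiusStructure X) : Prop :=
  ∀ d ∈ S.M, ∀ x y z u : X, Admissible x y z u →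
    (crtVec d x y z u).1 ≤ (crtVec d x y z u).2.1 + (crtVec d x y z u).2.2 ∧
    (crtVec d x y z u).2.1 ≤ (crtVec d x y z u).1 + (crtVec d x y z u).2.2 ∧
    (crtVec d x y z u).2.2 ≤ (crtVec d x y z u).1 + (crtVec d x y z u).2.1

/-- The topology of a Möbius space: generated by the open balls of the metrics of the
structure (centered at points distinct from the respective remote points) together with
the complements of the closed balls. -/
def mobiusTop {X : Type*} (S : MobiusStructure X) : TopologicalSpace X :=
  TopologicalSpace.generateFrom
    {s | ∃ d ∈ S.M, ∃ x : X, d.rem ≠ some x ∧ ∃ r : ℝ≥0∞, 0 < r ∧ r ≠ ⊤ ∧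
      (s = {y | d.d y x < r} ∨ s = {y | r < d.d y x})}

/-- Connected components of subsets with respect to the Möbius topology. -/
def mobiusCCIn {X : Type*} (S : MobiusStructure X) (F : Set X) (x : X) : Set X :=
  @connectedComponentIn X (mobiusTop S) F x

/-- The pair `(x,z)` separates the pair `(y,u)` in `σ`:  `y` and `u` lie in different
connected components of `σ \ {x,z}`. -/
def SeparatesIn {X : Type*} (S : MobiusStructure X) (σ : Set X) (x z y u : X) : Prop :=
  u ∉ mobiusCCIn S (σ \ {x, z}) y

/-- `σ` is homeomorphic to the circle `S¹` (with respect to the Möbius topology). -/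
def HomeoToCircle {X : Type*} (S : MobiusStructure X) (σ : Set X) : Prop :=
  letI : TopologicalSpace X := mobiusTop S
  Nonempty (σ ≃ₜ Metric.sphere (0 : ℂ) 1)

/-- `X` is homeomorphic to the sphere `Sⁿ ⊆ ℝ^{n+1}` (w.r.t. the Möbius topology). -/
def HomeoToSphere {X : Type*} (S : MobiusStructure X) (n : ℕ) : Prop :=
  letI : TopologicalSpace X := mobiusTop S
  Nonempty (X ≃ₜ Metric.sphere (0 : EuclideanSpace ℝ (Fin (n + 1))) 1)

/-- The subset `A ⊆ X` is homeomorphic to `ℝᵖ` (w.r.t. the Möbius topology). -/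
def SubsetHomeoToEuclidean {X : Type*} (S : MobiusStructure X) (A : Set X) (p : ℕ) : Prop :=
  letI : TopologicalSpace X := mobiusTop S
  Nonempty (A ≃ₜ EuclideanSpace ℝ (Fin p))

/-- The subset `A ⊆ X` is homeomorphic to `ℝ` (w.r.t. the Möbius topology). -/
def SubsetHomeoToReal {X : Type*} (S : MobiusStructure X) (A : Set X) : Prop :=
  letI : TopologicalSpace X := mobiusTop S
  Nonempty (A ≃ₜ ℝ)

/-- A Ptolemy circle: a subset homeomorphic to `S¹` on which the Ptolemy equality holds
for every quadruple of distinct points `(x,y,z,u)` such that `(x,z)` separates `(y,u)`. -/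
def IsPtolemyCircle {X : Type*} (S : MobiusStructure X) (σ : Set X) : Prop :=
  HomeoToCircle S σ ∧
  ∀ d ∈ S.M, ∀ x ∈ σ, ∀ y ∈ σ, ∀ z ∈ σ, ∀ u ∈ σ,
    x ≠ y → x ≠ z → x ≠ u → y ≠ z → y ≠ u → z ≠ u →
    SeparatesIn S σ x z y u →
    d.d x z * d.d y u = d.d x y * d.d z u + d.d x u * d.d y z

/-- A Möbius automorphism of `X`: a bijection preserving all cross-ratio triples. -/
def IsMobiusAuto {X : Type*} (S : MobiusStructure X) (f : X → X) : Prop :=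
  Function.Bijective f ∧ ∀ d ∈ S.M, ∀ x y z u : X, Admissible x y z u →
    ProjEq (crtVec d x y z u) (crtVec d (f x) (f y) (f z) (f u))

/-- A metric sphere between two distinct points `ω`, `ω'`. -/
def IsMetricSphere {X : Type*} (S : MobiusStructure X) (ω ω' : X) (Sp : Set X) : Prop :=
  ∃ d ∈ S.M, d.rem = some ω' ∧ ∃ r : ℝ≥0∞, 0 < r ∧ r ≠ ⊤ ∧ Sp = {x | d.d x ω = r}

/-- A space inversion with respect to `ω`, `ω'` and a metric sphere `Sp` between them. -/
def IsSpaceInversion {X : Type*} (S : MobiusStructure X) (ω ω' : X) (Sp : Set X)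
    (φ : X → X) : Prop :=
  IsMobiusAuto S φ ∧ Function.Involutive φ ∧ (∀ x, φ x ≠ x) ∧ φ ω = ω' ∧
  φ '' Sp = Sp ∧ ∀ σ : Set X, IsPtolemyCircle S σ → ω ∈ σ → ω' ∈ σ → φ '' σ = σ

/-- Property (E): existence of at least one Ptolemy circle. -/
def PropertyE {X : Type*} (S : MobiusStructure X) : Prop :=
  ∃ σ : Set X, IsPtolemyCircle S σ

/-- Property (I): existence and uniqueness of space inversions. -/
def PropertyI {X : Type*} (S : MobiusStructure X) : Prop :=
  ∀ ω ω' : X, ω ≠ ω' → ∀ Sp : Set X, IsMetricSphere S ω ω' Sp →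
    ∃! φ : X → X, IsSpaceInversion S ω ω' Sp φ

/-- The Möbius space is compact. -/
def MobiusCompact {X : Type*} (S : MobiusStructure X) : Prop :=
  letI : TopologicalSpace X := mobiusTop S
  CompactSpace X

/-- Property (H), the homothety property. -/
def PropertyH {X : Type*} (S : MobiusStructure X) : Prop :=
  ∀ ω ω' : X, ω ≠ ω' → ∀ σ : Set X, IsPtolemyCircle S σ → ω ∈ σ → ω' ∈ σ →
    ∀ x x' : X, x ∈ σ \ {ω, ω'} → x' ∈ mobiusCCIn S (σ \ {ω, ω'}) x →
    ∃ γ : X → X, IsMobiusAuto S γ ∧ γ ω = ω ∧ γ ω' = ω' ∧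
      (∀ σ' : Set X, IsPtolemyCircle S σ' → ω ∈ σ' → ω' ∈ σ' →
        γ '' σ' = σ' ∧ ∀ y ∈ σ' \ {ω, ω'}, γ y ∈ mobiusCCIn S (σ' \ {ω, ω'}) y) ∧
      γ x = x'

/-- A Ptolemy line in `X_ω`: a Ptolemy circle through `ω` with `ω` removed. -/
def IsPtolemyLine {X : Type*} (S : MobiusStructure X) (ω : X) (l : Set X) : Prop :=
  ∃ σ : Set X, IsPtolemyCircle S σ ∧ ω ∈ σ ∧ l = σ \ {ω}

/-- `c : ℝ → X` is a unit-speed parameterization of `l ⊆ X` w.r.t. the metric `d`. -/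
def IsUnitSpeed {X : Type*} (d : ExtMetric X) (l : Set X) (c : ℝ → X) : Prop :=
  Set.range c = l ∧ ∀ s t : ℝ, d.d (c s) (c t) = ENNReal.ofReal |s - t|

/-- `b` is a Busemann function of the Ptolemy line `l ⊆ X_ω`:  up to an additive constant,
`b x = lim_{t→∞} (d(x,c(t)) − t)` for a unit-speed parameterization `c` of `l`. -/
def IsBusemannOf {X : Type*} (S : MobiusStructure X) (d : ExtMetric X) (ω : X)
    (l : Set X) (b : X → ℝ) : Prop :=
  IsPtolemyLine S ω l ∧ ∃ c : ℝ → X, IsUnitSpeed d l c ∧ ∃ C : ℝ, ∀ x : X, x ≠ ω →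
    Filter.Tendsto (fun t => (d.d x (c t)).toReal - t) Filter.atTop (nhds (b x + C))

/-- The fiber through `x` of the canonical fibration `π_ω`: the set of points on which
every Busemann function of every Ptolemy line of `X_ω` takes the same value as at `x`. -/
def mobiusFiber {X : Type*} (S : MobiusStructure X) (d : ExtMetric X) (ω : X) (x : X) :
    Set X :=
  {y | y ≠ ω ∧ ∀ (l : Set X) (b : X → ℝ), IsBusemannOf S d ω l b → b y = b x}

/-- The base `B_ω` of the canonical fibration: the set of all fibers. -/
def mobiusBase {X : Type*} (S : MobiusStructure X) (d : ExtMetric X) (ω : X) :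
    Set (Set X) :=
  {F | ∃ x : X, x ≠ ω ∧ F = mobiusFiber S d ω x}

/-- The distance between two fibers. -/
noncomputable def fiberDist {X : Type*} (d : ExtMetric X) (F F' : Set X) : ℝ :=
  sInf {r : ℝ | ∃ x ∈ F, ∃ x' ∈ F', r = (d.d x x').toReal}

/-- Two Möbius spaces are Möbius equivalent: there is a bijection between them
preserving all cross-ratio triples. -/
def MobiusEquiv {X Y : Type*} (S : MobiusStructure X) (S' : MobiusStructure Y) : Prop :=
  ∃ f : X → Y, Function.Bijective f ∧ ∀ d ∈ S.M, ∀ d' ∈ S'.M, ∀ x y z u : X,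
    Admissible x y z u → ProjEq (crtVec d x y z u) (crtVec d' (f x) (f y) (f z) (f u))

/-- The standard extended Euclidean metric on the one-point extension
`ℝ̂ⁿ = ℝⁿ ∪ {∞}`, where `∞` is encoded by `none`. -/
noncomputable def stdExtMetric (n : ℕ) : ExtMetric (Option (EuclideanSpace ℝ (Fin n))) where
  d x y :=
    match x, y with
    | none, none => 0
    | none, some _ => ⊤
    | some _, none => ⊤
    | some a, some b => ENNReal.ofReal (dist a b)
  rem := some none
  symm := by intro x y; cases x <;> cases y <;> simp [dist_comm]
  d_self := by intro x; cases x <;> simp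
  pos := by
    intro x y h
    cases x <;> cases y
    · exact absurd rfl h
    · simp
    · simp
    · simp only [ne_eq, Option.some.injEq] at h
      exact ENNReal.ofReal_pos.mpr (dist_pos.mpr h)
  triangle := by
    intro x y z
    cases x <;> cases y <;> cases z <;>
      simp only [le_refl, le_top, zero_le, zero_add, add_zero, top_add, add_top,
        top_le_iff]
    rw [← ENNReal.ofReal_add dist_nonneg dist_nonneg]
    exact ENNReal.ofReal_le_ofReal (dist_triangle _ _ _)
  d_eq_top_iff := by
    intro x y
    cases x <;> cases y <;>
      simp [ENNReal.ofReal_ne_top]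


section PtolemaicLines

open Filter Topology

variable {Y : Type*} [MetricSpace Y]

/-- A metric space in which the Ptolemy inequality holds. -/
def PtolemyInequality (Y : Type*) [MetricSpace Y] : Prop :=
  ∀ x y z u : Y, dist x z * dist y u ≤ dist x y * dist z u + dist x u * dist y z

/-- An inversion with center `o` and radius `r`, defined away from its center, which acts on
every geodesic line through the center as `t ↦ -r² / t`. -/
structure IsInversionAt (o : Y) (r : ℝ) (φ : Y → Y) : Prop where
  dist_center : ∀ x, x ≠ o → dist (φ x) o = r ^ 2 / dist x o
  dist_eq : ∀ x y, x ≠ o → y ≠ o → dist (φ x) (φ y) = r ^ 2 * dist x y / (dist x o * dist y o)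
  line : ∀ c : ℝ → Y, Isometry c → c 0 = o → ∀ t, t ≠ 0 → φ (c t) = c (-r ^ 2 / t)

/-- A homothety with center `o` and factor `k`, which acts on every geodesic line through the
center as `t ↦ k t`. -/
structure IsDilationAt (o : Y) (k : ℝ) (h : Y → Y) : Prop where
  center : h o = o
  dist_eq : ∀ x y, dist (h x) (h y) = k * dist x y
  line : ∀ c : ℝ → Y, Isometry c → c 0 = o → ∀ t, h (c t) = c (k * t)

theorem IsInversionAt.ne {o : Y} {r : ℝ} (hr : 0 < r) {φ : Y → Y} (h : IsInversionAt o r φ)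
    {x : Y} (hx : x ≠ o) : φ x ≠ o := by
  have := h.dist_center x hx
  have hd : 0 < dist x o := dist_pos.2 hx
  rw [← dist_pos, this]
  positivity

theorem exists_isDilationAt (hinv : ∀ (o : Y) (r : ℝ), 0 < r → ∃ φ, IsInversionAt o r φ)
    (o : Y) {k : ℝ} (hk : 0 < k) : ∃ h, IsDilationAt o k h := by
  classical
  obtain ⟨φ, hφ⟩ := hinv o 1 one_pos
  obtain ⟨ψ, hψ⟩ := hinv o (√k) (Real.sqrt_pos.2 hk)
  have hsq : √k ^ 2 = k := Real.sq_sqrt hk.le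
  have hcenter : ∀ x, x ≠ o → dist (ψ (φ x)) o = k * dist x o := by
    intro x hx
    have hd : 0 < dist x o := dist_pos.2 hx
    rw [hψ.dist_center _ (hφ.ne one_pos hx), hφ.dist_center x hx, hsq]
    field_simp
  refine ⟨fun x => if x = o then o else ψ (φ x), by simp, ?_, ?_⟩
  · intro x y
    by_cases hx : x = o <;> by_cases hy : y = o
    · simp [hx, hy]
    · simp only [hx, hy, if_true, if_false]
      rw [dist_comm, hcenter y hy, dist_comm]
    · simp only [hx, hy, if_true, if_false]
      exact hcenter x hx
    · simp only [hx, hy, if_false]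
      have hdx : 0 < dist x o := dist_pos.2 hx
      have hdy : 0 < dist y o := dist_pos.2 hy
      rw [hψ.dist_eq _ _ (hφ.ne one_pos hx) (hφ.ne one_pos hy), hφ.dist_eq x y hx hy,
        hφ.dist_center x hx, hφ.dist_center y hy, hsq]
      field_simp
  · intro c hc hc0 t
    rcases eq_or_ne t 0 with rfl | ht
    · simp [hc0]
    · have : c t ≠ o := by
        rw [← hc0]
        exact fun h => ht (hc.injective h)
      simp only [this, if_false]
      rw [hφ.line c hc hc0 t ht, hψ.line c hc hc0 _ (by simpa using ht), hsq]
      congr 1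
      field_simp

/-- The Busemann function of the geodesic ray `c|[0,∞)`. -/
noncomputable def busemann (c : ℝ → Y) (x : Y) : ℝ :=
  ⨅ t : ℝ, (dist x (c t) - t)

theorem tendsto_busemann {c : ℝ → Y} (hc : Isometry c) (x : Y) :
    Tendsto (fun t => dist x (c t) - t) atTop (𝓝 (busemann c x)) := by
  apply tendsto_atTop_ciInf
  · intro s t hst
    have h1 := dist_triangle x (c s) (c t)
    rw [hc.dist_eq, Real.dist_eq, abs_sub_comm, abs_of_nonneg (sub_nonneg.2 hst)] at h1
    simp only
    linarith
  · refine ⟨-dist x (c 0), ?_⟩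
    rintro _ ⟨t, rfl⟩
    have h1 := dist_triangle (c t) x (c 0)
    rw [hc.dist_eq, Real.dist_eq, dist_comm (c t)] at h1
    have := le_abs_self (t - 0)
    simp only
    linarith

theorem busemann_line {c : ℝ → Y} (hc : Isometry c) (s : ℝ) : busemann c (c s) = -s := by
  refine tendsto_nhds_unique (tendsto_busemann hc (c s)) ?_
  refine tendsto_const_nhds.congr' ?_
  filter_upwards [eventually_ge_atTop s] with t ht
  rw [hc.dist_eq, Real.dist_eq, abs_sub_comm, abs_of_nonneg (sub_nonneg.2 ht)]
  ring

/-- In a Ptolemaic space, lines diverging sublinearly along some filter have Busemann functions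
that differ by a constant. -/
theorem busemann_sub_eq_of_sublinear (hpt : PtolemyInequality Y) {c c' : ℝ → Y}
    (hc : Isometry c) (hc' : Isometry c') {l : Filter ℝ} [l.NeBot] (hl : l ≤ atTop)
    (h : Tendsto (fun t => dist (c t) (c' t) / t) l (𝓝 0)) (x y : Y) :
    busemann c x - busemann c' x = busemann c y - busemann c' y := by
  have key : ∀ x y, busemann c x - busemann c' x ≤ busemann c y - busemann c' y := by
    intro x y
    have lim : ∀ {c₁ : ℝ → Y}, Isometry c₁ → ∀ z,
        Tendsto (fun t => dist z (c₁ t) - t) l (𝓝 (busemann c₁ z)) :=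
      fun h₁ z => (tendsto_busemann h₁ z).mono_left hl
    have hinv : Tendsto (fun t : ℝ => t⁻¹) l (𝓝 0) := tendsto_inv_atTop_zero.mono_left hl
    have hleft := (((lim hc x).mul (lim hc' y)).mul hinv).add ((lim hc x).add (lim hc' y))
    have hright := ((((lim hc' x).mul (lim hc y)).mul hinv).add
      ((lim hc' x).add (lim hc y))).add (h.const_mul (dist x y))
    have := le_of_tendsto_of_tendsto hleft hright ?_
    · linarith
    · filter_upwards [hl (eventually_gt_atTop 0)] with t ht
      have hP := hpt x y (c t) (c' t)
      have e1 : (dist x (c t) - t) * (dist y (c' t) - t) * t⁻¹ +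
          (dist x (c t) - t + (dist y (c' t) - t)) =
          dist x (c t) * dist y (c' t) / t - t := by
        field_simp
        ring
      have e2 : (dist x (c' t) - t) * (dist y (c t) - t) * t⁻¹ +
          (dist x (c' t) - t + (dist y (c t) - t)) + dist x y * (dist (c t) (c' t) / t) =
          (dist x y * dist (c t) (c' t) + dist x (c' t) * dist y (c t)) / t - t := by
        field_simp
        ring
      rw [e1, e2]
      gcongr
  exact le_antisymm (key x y) (key y x)

variable [ProperSpace Y]

/-- Through every point there is a geodesic line whose Busemann function agrees with a given one
up to a constant. -/
theorem exists_line_through (hpt : PtolemyInequality Y)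
    (hdil : ∀ (o : Y) (k : ℝ), 0 < k → ∃ h, IsDilationAt o k h)
    {L : ℝ → Y} (hL : Isometry L) (p : Y) :
    ∃ c : ℝ → Y, Isometry c ∧ c 0 = p ∧ ∀ x y, busemann c x - busemann L x =
      busemann c y - busemann L y := by
  have hpos : ∀ n : ℕ, (0 : ℝ) < 1 / ((n : ℝ) + 1) := fun n => by positivity
  choose h hh using fun n : ℕ => hdil p (1 / ((n : ℝ) + 1)) (hpos n)
  set U : Ultrafilter ℕ := hyperfilter ℕ
  have hU : (U : Filter ℕ) ≤ atTop := Nat.hyperfilter_le_atTop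
  set g : ℕ → ℝ → Y := fun n t => h n (L ((n + 1) * t))
  have hg : ∀ n, Isometry (g n) := by
    intro n
    refine Isometry.of_dist_eq fun s t => ?_
    simp only [g]
    rw [(hh n).dist_eq, hL.dist_eq, Real.dist_eq, Real.dist_eq, ← mul_sub, abs_mul,
      abs_of_pos (by positivity : (0 : ℝ) < n + 1)]
    field_simp
  have hg0 : ∀ n, dist (g n 0) p = 1 / ((n : ℝ) + 1) * dist (L 0) p := by
    intro n
    conv_lhs => rw [← (hh n).center]
    simp only [g]
    rw [(hh n).dist_eq, mul_zero]
  have hlim : ∀ t, ∃ y, Tendsto (fun n => g n t) U (𝓝 y) := by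
    intro t
    have hmem : ∀ n, g n t ∈ Metric.closedBall p (|t| + dist (L 0) p) := by
      intro n
      rw [Metric.mem_closedBall]
      have h1 := dist_triangle (g n t) (g n 0) p
      rw [(hg n).dist_eq, hg0, Real.dist_eq, sub_zero] at h1
      have h2 : 1 / ((n : ℝ) + 1) * dist (L 0) p ≤ 1 * dist (L 0) p := by
        gcongr
        rw [div_le_one (by positivity)]
        linarith [(Nat.cast_nonneg n : (0 : ℝ) ≤ n)]
      linarith
    obtain ⟨y, -, hy⟩ := (isCompact_closedBall p (|t| + dist (L 0) p)).ultrafilter_le_nhds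
      (U.map fun n => g n t) (by
        rw [le_principal_iff]
        exact Filter.mem_map.2 (Filter.univ_mem' hmem))
    exact ⟨y, hy⟩
  choose c hc using hlim
  have hciso : Isometry c := by
    refine Isometry.of_dist_eq fun s t => ?_
    refine tendsto_nhds_unique ((hc s).dist (hc t)) ?_
    simp only [(hg _).dist_eq]
    exact tendsto_const_nhds
  have hc0 : c 0 = p := by
    rw [← dist_eq_zero]
    refine tendsto_nhds_unique ((hc 0).dist tendsto_const_nhds) ?_
    simp only [hg0]
    have := (tendsto_one_div_add_atTop_nhds_zero_nat (𝕜 := ℝ)).mul_const (dist (L 0) p)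
    rw [zero_mul] at this
    exact this.mono_left hU
  refine ⟨c, hciso, hc0, ?_⟩
  have hT : Tendsto (fun n : ℕ => (n : ℝ) + 1) U atTop :=
    (tendsto_atTop_add_const_right _ _ tendsto_natCast_atTop_atTop).mono_left hU
  refine busemann_sub_eq_of_sublinear hpt hciso hL (l := map (fun n : ℕ => (n : ℝ) + 1) U) hT ?_
  rw [tendsto_map'_iff]
  have h1 : Tendsto (fun n => dist (c 1) (g n 1)) U (𝓝 0) := by
    have := (tendsto_const_nhds (x := c 1)).dist (hc 1)
    rwa [dist_self] at this
  refine h1.congr fun n => ?_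
  have h2 : h n (c (n + 1)) = c 1 := by
    rw [(hh n).line c hciso hc0]
    congr 1
    have : (n : ℝ) + 1 ≠ 0 := by positivity
    field_simp
  simp only [g, Function.comp]
  rw [← h2, (hh n).dist_eq, mul_one]
  ring

/-- Busemann functions are homogeneous with respect to dilations at arbitrary points. -/
theorem busemann_dilation (hpt : PtolemyInequality Y)
    (hdil : ∀ (o : Y) (k : ℝ), 0 < k → ∃ h, IsDilationAt o k h)
    {L : ℝ → Y} (hL : Isometry L) {p : Y} {k : ℝ} (hk : 0 < k) {h : Y → Y}
    (hh : IsDilationAt p k h) (x : Y) :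
    busemann L (h x) = busemann L p + k * (busemann L x - busemann L p) := by
  obtain ⟨c, hc, hc0, hcL⟩ := exists_line_through hpt hdil hL p
  have hp : busemann c p = 0 := by
    have := busemann_line hc 0
    rwa [hc0, neg_zero] at this
  have hx : busemann c (h x) = k * busemann c x := by
    have h1 : Tendsto (fun t => dist (h x) (c (k * t)) - k * t) atTop (𝓝 (busemann c (h x))) :=
      (tendsto_busemann hc (h x)).comp (tendsto_id.const_mul_atTop hk)
    refine tendsto_nhds_unique h1 (((tendsto_busemann hc x).const_mul k).congr fun t => ?_)
    rw [← hh.line c hc hc0, hh.dist_eq]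
    ring
  have h1 := hcL (h x) p
  have h2 := hcL x p
  rw [hp] at h1 h2
  rw [hx] at h1
  have h3 : busemann c x = busemann L x - busemann L p := by linarith
  rw [h3] at h1
  linarith

/-- The map to a product of lines whose coordinates are the Busemann functions normalized to
vanish at `o`. -/
noncomputable def busemannMap (o x : Y) : {c : ℝ → Y // Isometry c} → ℝ :=
  fun c => busemann c.1 x - busemann c.1 o

theorem busemannMap_dilation (hpt : PtolemyInequality Y)
    (hdil : ∀ (o : Y) (k : ℝ), 0 < k → ∃ h, IsDilationAt o k h)
    (o : Y) {p : Y} {k : ℝ} (hk : 0 < k) {h : Y → Y} (hh : IsDilationAt p k h) (x : Y) :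
    busemannMap o (h x) = busemannMap o p + k • (busemannMap o x - busemannMap o p) := by
  funext c
  simp only [busemannMap, Pi.add_apply, Pi.smul_apply, Pi.sub_apply, smul_eq_mul]
  rw [busemann_dilation hpt hdil c.2 hk hh]
  ring

omit [ProperSpace Y] in
theorem busemannMap_injective
    (hsep : ∀ x y : Y, x ≠ y → ∃ c : ℝ → Y, Isometry c ∧ busemann c x ≠ busemann c y) (o : Y) :
    Function.Injective (busemannMap o) := by
  intro x y h
  by_contra hxy
  obtain ⟨c, hc, hne⟩ := hsep x y hxy
  have := congrFun h ⟨c, hc⟩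
  simp only [busemannMap] at this
  exact hne (by linarith)

omit [ProperSpace Y] in
theorem busemannMap_self (o : Y) : busemannMap o o = 0 := by
  funext c
  simp [busemannMap]

/-- The image of the Busemann map is a linear subspace. -/
theorem exists_submodule_eq_range_busemannMap (hpt : PtolemyInequality Y)
    (hdil : ∀ (o : Y) (k : ℝ), 0 < k → ∃ h, IsDilationAt o k h) (o : Y) :
    ∃ W : Submodule ℝ ({c : ℝ → Y // Isometry c} → ℝ),
      (W : Set ({c : ℝ → Y // Isometry c} → ℝ)) = Set.range (busemannMap o) := by
  have h0 := busemannMap_self o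
  have hext : ∀ v ∈ Set.range (busemannMap o), ∀ w ∈ Set.range (busemannMap o),
      ∀ k : ℝ, 0 < k → v + k • (w - v) ∈ Set.range (busemannMap o) := by
    rintro _ ⟨p, rfl⟩ _ ⟨x, rfl⟩ k hk
    obtain ⟨h, hh⟩ := hdil p k hk
    exact ⟨h x, busemannMap_dilation hpt hdil o hk hh x⟩
  have hpos : ∀ v ∈ Set.range (busemannMap o), ∀ k : ℝ, 0 < k →
      k • v ∈ Set.range (busemannMap o) := by
    intro v hv k hk
    have := hext 0 ⟨o, h0⟩ v hv k hk
    simpa using this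
  refine ⟨{ carrier := Set.range (busemannMap o), zero_mem' := ⟨o, h0⟩, add_mem' := ?_,
            smul_mem' := ?_ }, rfl⟩
  · intro v w hv hw
    have := hpos _ (hext v hv w hw (1 / 2) (by norm_num)) 2 two_pos
    convert this using 1
    module
  · intro k v hv
    rcases lt_trichotomy k 0 with hk | rfl | hk
    · have h1 := hext v hv 0 ⟨o, h0⟩ 2 two_pos
      have h2 := hpos _ h1 (-k) (neg_pos.2 hk)
      convert h2 using 1
      module
    · rw [zero_smul]
      exact ⟨o, h0⟩
    · exact hpos v hv k hk

theorem dist_eq_of_busemannMap_sub_eq (hpt : PtolemyInequality Y)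
    (hdil : ∀ (o : Y) (k : ℝ), 0 < k → ∃ h, IsDilationAt o k h)
    (hsep : ∀ x y : Y, x ≠ y → ∃ c : ℝ → Y, Isometry c ∧ busemann c x ≠ busemann c y)
    (o : Y) {x y x' y' : Y}
    (h : busemannMap o y - busemannMap o x = busemannMap o y' - busemannMap o x') :
    dist x y = dist x' y' := by
  obtain ⟨g, hg⟩ := hdil x' 2 two_pos
  have hp := busemannMap_dilation hpt hdil o two_pos hg x
  set p := g x
  obtain ⟨f, hf⟩ := hdil x (1 / 2) (by norm_num)
  obtain ⟨f', hf'⟩ := hdil p 2 two_pos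
  have hT : ∀ z, busemannMap o (f' (f z)) =
      busemannMap o z - busemannMap o x + busemannMap o x' := by
    intro z
    rw [busemannMap_dilation hpt hdil o two_pos hf',
      busemannMap_dilation hpt hdil o (by norm_num) hf, hp]
    module
  have hx : f' (f x) = x' := busemannMap_injective hsep o (by rw [hT]; simp)
  have hy : f' (f y) = y' := busemannMap_injective hsep o (by rw [hT, h]; simp)
  rw [← hx, ← hy, hf'.dist_eq, hf.dist_eq]
  ring

theorem exists_isometryEquiv_of_core {W : Type*} [AddCommGroup W] [Module ℝ W] [Nontrivial Y]
    (e : W ≃ Y) (cd : InnerProductSpace.Core ℝ W)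
    (hd : ∀ v w, dist (e v) (e w) ^ 2 = cd.inner (v - w) (v - w)) :
    ∃ n : ℕ, 1 ≤ n ∧ Nonempty (Y ≃ᵢ EuclideanSpace ℝ (Fin n)) := by
  let _ : NormedAddCommGroup W := cd.toNormedAddCommGroup
  let _ : InnerProductSpace ℝ W := InnerProductSpace.ofCore cd.toCore
  have hiso : Isometry e := by
    refine Isometry.of_dist_eq fun v w => ?_
    rw [dist_eq_norm, ← Real.sqrt_sq (dist_nonneg (x := e v)), hd,
      ← Real.sqrt_sq (norm_nonneg (v - w)), ← real_inner_self_eq_norm_sq]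
  let E : W ≃ᵢ Y := ⟨e, hiso⟩
  have : ProperSpace W := E.symm.isometry.antilipschitz.properSpace E.symm.continuous
    E.symm.surjective
  have : FiniteDimensional ℝ W := FiniteDimensional.of_locallyCompactSpace ℝ
  have : Nontrivial W := e.nontrivial
  exact ⟨Module.finrank ℝ W, Module.finrank_pos,
    ⟨E.symm.trans (stdOrthonormalBasis ℝ W).repr.toIsometryEquiv⟩⟩

/-- A proper Ptolemaic metric space with an inversion of every radius at every point and
whose points are separated by Busemann functions is isometric to a Euclidean space. -/
theorem exists_isometryEquiv_euclideanSpace (hpt : PtolemyInequality Y)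
    (hinv : ∀ (o : Y) (r : ℝ), 0 < r → ∃ φ, IsInversionAt o r φ)
    (hsep : ∀ x y : Y, x ≠ y → ∃ c : ℝ → Y, Isometry c ∧ busemann c x ≠ busemann c y)
    [Nontrivial Y] :
    ∃ n : ℕ, 1 ≤ n ∧ Nonempty (Y ≃ᵢ EuclideanSpace ℝ (Fin n)) := by
  have hdil : ∀ (o : Y) (k : ℝ), 0 < k → ∃ h, IsDilationAt o k h :=
    fun o k hk => exists_isDilationAt hinv o hk
  obtain ⟨o⟩ := (inferInstance : Nonempty Y)
  obtain ⟨W, hW⟩ := exists_submodule_eq_range_busemannMap hpt hdil o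
  let e' : Y ≃ W := (Equiv.ofInjective _ (busemannMap_injective hsep o)).trans
    (Equiv.setCongr hW.symm)
  have he' : ∀ y, ((e' y : W) : {c : ℝ → Y // Isometry c} → ℝ) = busemannMap o y := fun y => rfl
  let e : W ≃ Y := e'.symm
  have he : ∀ v : W, busemannMap o (e v) = v := fun v => by rw [← he', e'.apply_symm_apply]
  have he0 : e 0 = o := by
    apply busemannMap_injective hsep o
    rw [he, busemannMap_self, Submodule.coe_zero]
  let N : W → ℝ := fun v => dist (e v) o
  have hN : ∀ v w, dist (e v) (e w) = N (v - w) := by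
    intro v w
    refine dist_eq_of_busemannMap_sub_eq hpt hdil hsep o ?_
    rw [he, he, busemannMap_self, he]
    simp
  have hNneg : ∀ v, N (-v) = N v := by
    intro v
    have h1 := hN 0 v
    rw [he0, dist_comm, zero_sub] at h1
    exact h1.symm
  have hNpos : ∀ v (k : ℝ), 0 < k → N (k • v) = k * N v := by
    intro v k hk
    obtain ⟨h, hh⟩ := hdil o k hk
    have h1 : e (k • v) = h (e v) := by
      apply busemannMap_injective hsep o
      rw [busemannMap_dilation hpt hdil o hk hh, he, he, busemannMap_self]
      simp
    change dist (e (k • v)) o = k * dist (e v) o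
    rw [h1]
    conv_lhs => rw [← hh.center]
    exact hh.dist_eq _ _
  have hN0 : N 0 = 0 := by simp [N, he0]
  have hNsmul : ∀ v (k : ℝ), N (k • v) = |k| * N v := by
    intro v k
    rcases lt_trichotomy k 0 with hk | rfl | hk
    · rw [abs_of_neg hk, ← hNpos v (-k) (neg_pos.2 hk), ← hNneg, show -(k • v) = -k • v by module]
    · simp [hN0]
    · rw [abs_of_pos hk, hNpos v k hk]
  have hNeq0 : ∀ v, N v = 0 → v = 0 := by
    intro v hv
    exact e.injective ((dist_eq_zero.1 hv).trans he0.symm)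
  have hline : ∀ v, N v = 1 → Isometry fun t : ℝ => e (t • v) := by
    intro v hv
    refine Isometry.of_dist_eq fun s t => ?_
    rw [hN, show s • v - t • v = (s - t) • v by module, hNsmul, hv, mul_one, Real.dist_eq]
  have hunit : ∀ v, v ≠ 0 → N ((N v)⁻¹ • v) = 1 := by
    intro v hv
    have h1 : 0 < N v := lt_of_le_of_ne dist_nonneg fun h => hv (hNeq0 v h.symm)
    rw [hNpos _ _ (inv_pos.2 h1), inv_mul_cancel₀ h1.ne']
  have hcoord : ∀ (v : W) (hv : N v = 1) (w : W),
      Filter.Tendsto (fun t : ℝ => N (w - t • v) - t) Filter.atTop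
        (nhds (w.1 ⟨_, hline v hv⟩)) := by
    intro v hv w
    have h1 := tendsto_busemann (hline v hv) (e w)
    have h2 : busemann (fun t : ℝ => e (t • v)) o = 0 := by
      have := busemann_line (hline v hv) 0
      simpa [he0] using this
    have h3 : w.1 ⟨_, hline v hv⟩ = busemann (fun t : ℝ => e (t • v)) (e w) := by
      rw [← he w]
      simp [busemannMap, h2]
    rw [h3]
    simpa only [hN] using h1
  obtain ⟨φ, hφ⟩ := hinv o 1 one_pos
  have hsymm : ∀ v w, N v = 1 → N w = 1 → ∀ t : ℝ, 0 < t → N (v - t • w) = N (w - t • v) := by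
    intro v w hv hw t ht
    have hφv := hφ.line _ (hline v hv) (by simp [he0]) 1 one_ne_zero
    have hφw := hφ.line _ (hline w hw) (by simp [he0]) t ht.ne'
    have hv1 : N ((1 : ℝ) • v) = 1 := by simpa using hv
    have hwt : N (t • w) = t := by rw [hNpos w t ht, hw, mul_one]
    have hvo : e ((1 : ℝ) • v) ≠ o := by
      rw [← dist_pos]
      change 0 < N _
      rw [hv1]
      exact one_pos
    have hwo : e (t • w) ≠ o := by
      rw [← dist_pos]
      change 0 < N _
      rwa [hwt]
    have h1 := hφ.dist_eq _ _ hvo hwo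
    rw [hφv, hφw] at h1
    change _ = _ / (N _ * N _) at h1
    rw [hv1, hwt, hN, hN] at h1
    have h2 : N (w - t • v) = t * N ((-1 ^ 2 / 1 : ℝ) • v - (-1 ^ 2 / t) • w) := by
      rw [← hNpos _ t ht]
      congr 1
      rw [smul_sub, smul_smul, smul_smul, mul_div_cancel₀ _ ht.ne']
      module
    rw [h2, h1]
    simp only [one_smul]
    field_simp
  have hcoordsymm : ∀ v w (hv : N v = 1) (hw : N w = 1),
      v.1 ⟨_, hline w hw⟩ = w.1 ⟨_, hline v hv⟩ := by
    intro v w hv hw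
    refine tendsto_nhds_unique (hcoord w hw v) ((hcoord v hv w).congr' ?_)
    filter_upwards [Filter.eventually_gt_atTop 0] with t ht
    rw [hsymm v w hv hw t ht]
  classical
  let B : W → W → ℝ := fun w v =>
    if hv : v = 0 then 0 else -N v * w.1 ⟨_, hline _ (hunit v hv)⟩
  have hBself : ∀ v, B v v = N v ^ 2 := by
    intro v
    by_cases hv : v = 0
    · simp [B, hv, hN0]
    · have hpos : N v ≠ 0 := fun h => hv (hNeq0 v h)
      have h1 := hcoord _ (hunit v hv) v
      have h2 : v.1 ⟨_, hline _ (hunit v hv)⟩ = -N v := by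
        refine tendsto_nhds_unique h1 (tendsto_const_nhds.congr' ?_)
        filter_upwards [Filter.eventually_gt_atTop (N v)] with t ht
        have h3 : v - t • (N v)⁻¹ • v = (1 - t * (N v)⁻¹) • v := by module
        have h4 : 0 < N v := lt_of_le_of_ne dist_nonneg hpos.symm
        have h5 : 1 - t * (N v)⁻¹ < 0 := by
          rw [sub_neg, ← div_eq_mul_inv, lt_div_iff₀ h4]
          linarith
        rw [h3, hNsmul, abs_of_neg h5]
        field_simp
        ring
      simp only [B, hv, dif_neg, not_false_iff]
      rw [h2]
      ring
  have hBsymm : ∀ v w, B v w = B w v := by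
    intro v w
    by_cases hv : v = 0
    · simp [B, hv]
    by_cases hw : w = 0
    · simp [B, hw]
    have h1 : ∀ (v : W) (i), v ≠ 0 → v.1 i = N v * ((N v)⁻¹ • v).1 i := by
      intro v i hv
      have : N v ≠ 0 := fun h => hv (hNeq0 v h)
      simp [this]
    simp only [B, hv, hw, dif_neg, not_false_iff]
    rw [h1 v _ hv, h1 w _ hw, hcoordsymm _ _ (hunit v hv) (hunit w hw)]
    ring
  let cd : InnerProductSpace.Core ℝ W :=
    { inner := B
      conj_inner_symm := fun x y => hBsymm y x
      re_inner_nonneg := fun x => by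
        change 0 ≤ B x x
        rw [hBself]
        positivity
      add_left := fun x y z => by
        by_cases hz : z = 0
        · simp [B, hz]
        · simp [B, hz, mul_add]
          ring
      smul_left := fun x y r => by
        by_cases hz : y = 0
        · simp [B, hz]
        · simp [B, hz]
          ring
      definite := fun x hx => by
        change B x x = 0 at hx
        rw [hBself] at hx
        exact hNeq0 x (by simpa using hx) }
  refine exists_isometryEquiv_of_core e cd fun v w => ?_
  rw [hN]
  exact (hBself _).symm

end PtolemaicLines

section CircleTopology

open Filter Topology Set OnePoint

/-- If the complement of a point of a compact space carries a metric whose open balls are open and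
whose closed balls are closed, then the metric induces the subspace topology and is proper. -/
theorem isOpenEmbedding_of_balls {X Y : Type*} [TopologicalSpace X] [CompactSpace X]
    [MetricSpace Y] {i : Y → X} (hi : Function.Injective i)
    (hball : ∀ y r, 0 < r → IsOpen (i '' Metric.ball y r))
    (hcball : ∀ y r, 0 < r → IsClosed (i '' Metric.closedBall y r)) :
    IsOpenEmbedding i ∧ ProperSpace Y := by
  have hopen : IsOpenMap i := by
    intro U hU
    have hU' : i '' U = ⋃ p : {p : Y × ℝ // 0 < p.2 ∧ Metric.ball p.1 p.2 ⊆ U},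
        i '' Metric.ball p.1.1 p.1.2 := by
      rw [← image_iUnion]
      congr 1
      ext y
      simp only [mem_iUnion]
      constructor
      · intro hy
        obtain ⟨r, hr, h⟩ := Metric.isOpen_iff.1 hU y hy
        exact ⟨⟨(y, r), hr, h⟩, Metric.mem_ball_self hr⟩
      · rintro ⟨p, hp⟩
        exact p.2.2 hp
    rw [hU']
    exact isOpen_iUnion fun p => hball _ _ p.2.1
  have hcompact : ∀ K : Set Y, IsClosed (i '' K) → IsCompact K := by
    intro K hK
    rcases isEmpty_or_nonempty Y with h | h
    · rw [K.eq_empty_of_isEmpty]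
      exact isCompact_empty
    have h1 := hopen.continuousOn_range_of_leftInverse (Function.leftInverse_invFun hi)
    have h2 := hK.isCompact.image_of_continuousOn (h1.mono (image_subset_range _ _))
    rwa [(Function.leftInverse_invFun hi).image_image] at h2
  have hcont : Continuous i := by
    rw [continuous_iff_continuousAt]
    intro y U hU
    obtain ⟨V, hVU, hV, hyV⟩ := mem_nhds_iff.1 hU
    have hK : IsCompact (Metric.closedBall y 1 \ i ⁻¹' V) := by
      apply hcompact
      rw [image_sdiff_preimage]
      exact (hcball y 1 one_pos).sdiff hV
    have h1 : (Metric.closedBall y 1 \ i ⁻¹' V)ᶜ ∩ Metric.ball y 1 ∈ 𝓝 y :=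
      inter_mem (hK.isClosed.isOpen_compl.mem_nhds fun h => h.2 hyV)
        (Metric.ball_mem_nhds y one_pos)
    refine mem_map.2 (mem_of_superset h1 ?_)
    rintro z ⟨hz, hz1⟩
    by_contra hzU
    exact hz ⟨Metric.ball_subset_closedBall hz1, fun h => hzU (hVU h)⟩
  refine ⟨.of_continuous_injective_isOpenMap hcont hi hopen,
    .of_isCompact_closedBall_of_le 1 fun y r hr => hcompact _ (hcball y r (by linarith))⟩

theorem t2Space_of_balls {X Y : Type*} [TopologicalSpace X] [MetricSpace Y] {i : Y → X} {ω : X}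
    (hr : range i = {ω}ᶜ) (hi : Function.Injective i)
    (hball : ∀ y r, 0 < r → IsOpen (i '' Metric.ball y r))
    (hcball : ∀ y r, 0 < r → IsClosed (i '' Metric.closedBall y r)) : T2Space X := by
  have hω : ∀ y, i y ≠ ω := fun y => by
    have : i y ∈ range i := mem_range_self y
    rwa [hr] at this
  have hsurj : ∀ x, x ≠ ω → ∃ y, i y = x := fun x hx => by
    have : x ∈ range i := by rwa [hr]
    exact this
  have key : ∀ y x, x ≠ i y → ∃ u v : Set X, IsOpen u ∧ IsOpen v ∧ i y ∈ u ∧ x ∈ v ∧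
      Disjoint u v := by
    intro y x hxy
    by_cases hx : x = ω
    · refine ⟨i '' Metric.ball y 1, (i '' Metric.closedBall y 1)ᶜ, hball y 1 one_pos,
        (hcball y 1 one_pos).isOpen_compl, mem_image_of_mem i (Metric.mem_ball_self one_pos), ?_, ?_⟩
      · rintro ⟨z, -, hz⟩
        exact hω z (hz.trans hx)
      · rw [disjoint_compl_right_iff_subset]
        exact image_mono Metric.ball_subset_closedBall
    · obtain ⟨z, rfl⟩ := hsurj x hx
      have hd : 0 < dist y z / 2 := half_pos (dist_pos.2 fun h => hxy (h ▸ rfl))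
      refine ⟨_, _, hball y _ hd, hball z _ hd, mem_image_of_mem i (Metric.mem_ball_self hd),
        mem_image_of_mem i (Metric.mem_ball_self hd), ?_⟩
      rw [disjoint_image_iff hi]
      exact Metric.ball_disjoint_ball (by linarith)
  refine ⟨fun x x' hxx' => ?_⟩
  by_cases hx : x = ω
  · obtain ⟨y, rfl⟩ := hsurj x' (hx ▸ hxx'.symm)
    obtain ⟨u, v, hu, hv, h1, h2, h3⟩ := key y x hxx'
    exact ⟨v, u, hv, hu, h2, h1, h3.symm⟩
  · obtain ⟨y, rfl⟩ := hsurj x hx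
    exact key y x' hxx'.symm

/-- The unit circle is the one-point compactification of the real line, with any prescribed point
at infinity. -/
theorem exists_homeomorph_onePoint_circle (v : Metric.sphere (0 : ℂ) 1) :
    ∃ h : OnePoint ℝ ≃ₜ Metric.sphere (0 : ℂ) 1, h ∞ = v := by
  have hv : ‖(v : ℂ)‖ = 1 := norm_eq_of_mem_sphere v
  have : Fact (Module.finrank ℝ ℂ = 1 + 1) := ⟨Complex.finrank_real_complex⟩
  have hv0 : (v : ℂ) ≠ 0 := fun h => by simp [h] at hv
  have hdim : Module.finrank ℝ ℝ = Module.finrank ℝ (Submodule.span ℝ {(v : ℂ)})ᗮ := by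
    rw [Submodule.finrank_orthogonal_span_singleton (n := 1) hv0, Module.finrank_self]
  let e : ℝ ≃ₜ (Submodule.span ℝ {(v : ℂ)})ᗮ :=
    (FiniteDimensional.nonempty_continuousLinearEquiv_of_finrank_eq hdim).some.toHomeomorph
  exact ⟨e.onePointCongr.trans (onePointHyperplaneHomeoUnitSphere hv), rfl⟩

variable {X : Type*} [TopologicalSpace X]

theorem exists_onePoint_param {σ : Set X} (h : Nonempty (σ ≃ₜ Metric.sphere (0 : ℂ) 1)) {ω : X}
    (hω : ω ∈ σ) : ∃ κ : OnePoint ℝ → X, Continuous κ ∧ Function.Injective κ ∧ κ ∞ = ω ∧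
      range κ = σ := by
  obtain ⟨h⟩ := h
  obtain ⟨g, hg⟩ := exists_homeomorph_onePoint_circle (h ⟨ω, hω⟩)
  refine ⟨fun p => (h.symm (g p) : X), by fun_prop,
    Subtype.val_injective.comp (h.symm.injective.comp g.injective), by simp [hg], ?_⟩
  have := ((h.symm.surjective.comp g.surjective).range_comp (Subtype.val : σ → X))
  rw [Subtype.range_val] at this
  exact this

theorem homeomorph_circle_of_param [T2Space X] {κ : OnePoint ℝ → X} (hκ : Continuous κ)
    (hinj : Function.Injective κ) : Nonempty (range κ ≃ₜ Metric.sphere (0 : ℂ) 1) := by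
  obtain ⟨g, -⟩ := exists_homeomorph_onePoint_circle ⟨1, by simp⟩
  exact ⟨(hκ.isClosedEmbedding hinj).isEmbedding.toHomeomorph.symm.trans g⟩

theorem infty_notMem_connectedComponentIn [T2Space X] {κ : OnePoint ℝ → X} (hκ : Continuous κ)
    (hinj : Function.Injective κ) {s t u : ℝ} (hst : s < t) (htu : t < u) :
    κ ∞ ∉ connectedComponentIn (range κ \ {κ s, κ u}) (κ t) := by
  intro hmem
  set T := connectedComponentIn (range κ \ {κ s, κ u}) (κ t)
  have hclosed : ∀ A : Set (OnePoint ℝ), IsClosed A → IsClosed (κ '' A) :=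
    fun A hA => (hκ.isClosedEmbedding hinj).isClosedMap A hA
  have hU : IsOpen (κ '' (OnePoint.some '' Ioo s u)ᶜ)ᶜ :=
    (hclosed _ (isOpen_image_coe.2 isOpen_Ioo).isClosed_compl).isOpen_compl
  have hV : IsOpen (κ '' (OnePoint.some '' Icc s u))ᶜ :=
    (hclosed _ (isClosed_image_coe.2 ⟨isClosed_Icc, isCompact_Icc⟩)).isOpen_compl
  have htmem : κ t ∈ range κ \ {κ s, κ u} := by
    refine ⟨mem_range_self _, ?_⟩
    rintro (h | h)
    · exact hst.ne' (coe_injective (hinj h))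
    · exact htu.ne (coe_injective (hinj h))
  have hTsub : T ⊆ range κ \ {κ s, κ u} := connectedComponentIn_subset _ _
  obtain ⟨x, hxT, hxU, hxV⟩ := isPreconnected_connectedComponentIn _ _ hU hV
    (by
      intro x hx
      obtain ⟨⟨p, rfl⟩, hne⟩ := hTsub hx
      by_cases hp : p ∈ (OnePoint.some '' Icc s u : Set (OnePoint ℝ))
      · left
        rintro ⟨q, hq, hqp⟩
        rw [hinj hqp] at hq
        obtain ⟨r, ⟨h1, h2⟩, rfl⟩ := hp
        have h3 : r ≠ s := fun h => hne (by simp [h])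
        have h4 : r ≠ u := fun h => hne (by simp [h])
        exact hq ⟨r, ⟨lt_of_le_of_ne h1 h3.symm, lt_of_le_of_ne h2 h4⟩, rfl⟩
      · right
        rintro ⟨q, hq, hqp⟩
        rw [hinj hqp] at hq
        exact hp hq)
    ⟨κ t, mem_connectedComponentIn htmem, by
      rintro ⟨q, hq, hqp⟩
      rw [hinj hqp] at hq
      exact hq ⟨t, ⟨hst, htu⟩, rfl⟩⟩
    ⟨κ ∞, hmem, by
      rintro ⟨q, ⟨r, -, rfl⟩, hqp⟩
      exact coe_ne_infty r (hinj hqp)⟩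
  obtain ⟨⟨p, rfl⟩, -⟩ := hTsub hxT
  by_cases hp : p ∈ (OnePoint.some '' Icc s u : Set (OnePoint ℝ))
  · exact hxV ⟨p, hp, rfl⟩
  · refine hxU ⟨p, fun h => hp ?_, rfl⟩
    exact image_mono Ioo_subset_Icc_self h

theorem mem_connectedComponentIn_of_param {κ : OnePoint ℝ → X} (hκ : Continuous κ)
    (hinj : Function.Injective κ) {P : Set (OnePoint ℝ)} (hP : IsPreconnected P)
    {x y z u : OnePoint ℝ} (hy : y ∈ P) (hu : u ∈ P) (hx : x ∉ P) (hz : z ∉ P) :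
    κ u ∈ connectedComponentIn (range κ \ {κ x, κ z}) (κ y) := by
  refine (hP.image κ hκ.continuousOn).subset_connectedComponentIn (mem_image_of_mem κ hy) ?_
    (mem_image_of_mem κ hu)
  rintro _ ⟨p, hp, rfl⟩
  refine ⟨mem_range_self p, ?_⟩
  rintro (h | h)
  · exact hx (hinj h ▸ hp)
  · exact hz (hinj h ▸ hp)

theorem isPreconnected_image_coe {s : Set ℝ} (hs : s.OrdConnected) :
    IsPreconnected (OnePoint.some '' s : Set (OnePoint ℝ)) :=
  hs.isPreconnected.image _ continuous_coe.continuousOn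

theorem isPreconnected_insert_infty {s : Set ℝ} (hs : s.OrdConnected)
    (hub : ¬ ∃ R, s ⊆ Metric.closedBall 0 R) :
    IsPreconnected (insert (∞ : OnePoint ℝ) (OnePoint.some '' s : Set (OnePoint ℝ))) := by
  refine (isPreconnected_image_coe hs).subset_closure (subset_insert _ _)
    (insert_subset ?_ subset_closure)
  rw [mem_closure_iff_nhds]
  intro V hV
  obtain ⟨K, ⟨hK, hK'⟩, hKV⟩ := hasBasis_nhds_infty.mem_iff.1 hV
  obtain ⟨R, hR⟩ := hK'.isBounded.subset_closedBall 0
  by_contra hne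
  refine hub ⟨R, fun t ht => hR ?_⟩
  by_contra htK
  exact hne ⟨t, hKV (Or.inl ⟨t, htK, rfl⟩), t, ht, rfl⟩

theorem isPreconnected_insert_infty_Iic (a : ℝ) :
    IsPreconnected (insert (∞ : OnePoint ℝ) (OnePoint.some '' Iic a : Set (OnePoint ℝ))) := by
  refine isPreconnected_insert_infty ordConnected_Iic ?_
  rintro ⟨R, hR⟩
  have h1 := hR (mem_Iic.2 (min_le_left a (-|R| - 1)))
  rw [mem_closedBall_zero_iff, Real.norm_eq_abs, abs_le] at h1
  have := min_le_right a (-|R| - 1)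
  have := le_abs_self R
  linarith

theorem isPreconnected_insert_infty_Ici (a : ℝ) :
    IsPreconnected (insert (∞ : OnePoint ℝ) (OnePoint.some '' Ici a : Set (OnePoint ℝ))) := by
  refine isPreconnected_insert_infty ordConnected_Ici ?_
  rintro ⟨R, hR⟩
  have h1 := hR (mem_Ici.2 (le_max_left a (|R| + 1)))
  rw [mem_closedBall_zero_iff, Real.norm_eq_abs, abs_le] at h1
  have := le_max_right a (|R| + 1)
  have := le_abs_self R
  linarith

end CircleTopology

section Separation

open OnePoint Set

/-- Homogeneous coordinates of a point of the projective line. -/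
noncomputable def homogeneous : OnePoint ℝ → ℝ × ℝ :=
  fun p => p.elim (1, 0) (fun t => (t, 1))

/-- The determinant of the homogeneous coordinates of two points of the projective line. -/
noncomputable def bracket (p q : OnePoint ℝ) : ℝ :=
  (homogeneous p).1 * (homogeneous q).2 - (homogeneous p).2 * (homogeneous q).1

theorem bracket_mul_eq_add (x y z u : OnePoint ℝ) :
    bracket x z * bracket y u = bracket x y * bracket z u + bracket x u * bracket y z := by
  simp only [bracket]
  ring

@[simp] theorem bracket_coe (s t : ℝ) : bracket s t = s - t := by simp [bracket, homogeneous]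

@[simp] theorem bracket_coe_infty (s : ℝ) : bracket s ∞ = -1 := by simp [bracket, homogeneous]

@[simp] theorem bracket_infty_coe (s : ℝ) : bracket ∞ s = 1 := by simp [bracket, homogeneous]

@[simp] theorem bracket_self (p : OnePoint ℝ) : bracket p p = 0 := by
  simp only [bracket]
  ring

theorem abs_bracket_mul_eq_add {x y z u : OnePoint ℝ}
    (h : 0 ≤ bracket x y * bracket z u * (bracket x u * bracket y z)) :
    |bracket x z| * |bracket y u| =
      |bracket x y| * |bracket z u| + |bracket x u| * |bracket y z| := by
  rw [← abs_mul, ← abs_mul, ← abs_mul, bracket_mul_eq_add, abs_add_eq_add_abs_iff]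
  exact mul_nonneg_iff.1 h

theorem isPreconnected_infty_union (a b : ℝ) :
    IsPreconnected (insert (∞ : OnePoint ℝ) (OnePoint.some '' Iic a) ∪
      insert (∞ : OnePoint ℝ) (OnePoint.some '' Ici b)) :=
  IsPreconnected.union (∞ : OnePoint ℝ) (mem_insert _ _) (mem_insert _ _) (isPreconnected_insert_infty_Iic a)
    (isPreconnected_insert_infty_Ici b)

theorem exists_isPreconnected_of_lt {a b y u : ℝ} (hab : a < b)
    (h : 0 < (a - y) * (b - u) * ((a - u) * (b - y))) :
    ∃ P : Set (OnePoint ℝ), IsPreconnected P ∧ ↑y ∈ P ∧ ↑u ∈ P ∧ ↑a ∉ P ∧ ↑b ∉ P := by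
  have hay : y ≠ a := by rintro rfl; simp at h
  have hby : y ≠ b := by rintro rfl; simp at h
  have hau : u ≠ a := by rintro rfl; simp at h
  have hbu : u ≠ b := by rintro rfl; simp at h
  have mem : ∀ {s : Set ℝ} {t : ℝ}, (↑t : OnePoint ℝ) ∈ OnePoint.some '' s ↔ t ∈ s :=
    OnePoint.coe_injective.mem_set_image
  have sgn : ∀ t, t ≠ a → t ≠ b → t < a ∨ (a < t ∧ t < b) ∨ b < t := fun t h1 h2 => by
    rcases h1.lt_or_gt with h1 | h1 <;> rcases h2.lt_or_gt with h2 | h2 <;> grind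
  have key : ∀ {s t : ℝ}, (s < a ∨ b < s) → a < t → t < b →
      (a - s) * (b - t) * ((a - t) * (b - s)) < 0 := by
    intro s t hs h1 h2
    have h3 : 0 < (a - s) * (b - s) := by
      rcases hs with hs | hs
      · exact mul_pos (by linarith) (by linarith)
      · exact mul_pos_of_neg_of_neg (by linarith) (by linarith)
    have h4 : 0 < (b - t) * (t - a) := mul_pos (by linarith) (by linarith)
    linarith [mul_pos h3 h4]
  rcases sgn y hay hby with hy | ⟨hy1, hy2⟩ | hy <;>
    rcases sgn u hau hbu with hu | ⟨hu1, hu2⟩ | hu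
  · refine ⟨_, isPreconnected_image_coe ordConnected_Iio, mem.2 hy, mem.2 hu, ?_, ?_⟩ <;>
    · rw [mem, mem_Iio]
      linarith
  · linarith [key (.inl hy) hu1 hu2]
  · exact ⟨_, isPreconnected_infty_union y u, by simp, by simp,
      by simp only [mem_union, mem_insert_iff, coe_ne_infty, mem, mem_Iic, mem_Ici]; grind,
      by simp only [mem_union, mem_insert_iff, coe_ne_infty, mem, mem_Iic, mem_Ici]; grind⟩
  · linarith [key (.inl hu) hy1 hy2]
  · refine ⟨_, isPreconnected_image_coe ordConnected_Ioo, mem.2 ⟨hy1, hy2⟩, mem.2 ⟨hu1, hu2⟩,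
      ?_, ?_⟩ <;>
    · rw [mem]
      simp
  · linarith [key (.inr hu) hy1 hy2]
  · exact ⟨_, isPreconnected_infty_union u y, by simp, by simp,
      by simp only [mem_union, mem_insert_iff, coe_ne_infty, mem, mem_Iic, mem_Ici]; grind,
      by simp only [mem_union, mem_insert_iff, coe_ne_infty, mem, mem_Iic, mem_Ici]; grind⟩
  · linarith [key (.inr hy) hu1 hu2]
  · refine ⟨_, isPreconnected_image_coe ordConnected_Ioi, mem.2 hy, mem.2 hu, ?_, ?_⟩ <;>
    · rw [mem, mem_Ioi]
      linarith

theorem exists_isPreconnected_coe {a y u : ℝ} (h : 0 < (a - y) * (a - u)) :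
    ∃ P : Set (OnePoint ℝ), IsPreconnected P ∧ ↑y ∈ P ∧ ↑u ∈ P ∧ ↑a ∉ P ∧ (∞ : OnePoint ℝ) ∉ P := by
  have mem : ∀ {s : Set ℝ} {t : ℝ}, (↑t : OnePoint ℝ) ∈ OnePoint.some '' s ↔ t ∈ s :=
    OnePoint.coe_injective.mem_set_image
  rcases pos_and_pos_or_neg_and_neg_of_mul_pos h with ⟨h1, h2⟩ | ⟨h1, h2⟩
  · exact ⟨_, isPreconnected_image_coe (ordConnected_Iio (a := a)), mem.2 (sub_pos.1 h1),
      mem.2 (sub_pos.1 h2), by simp, by simp⟩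
  · exact ⟨_, isPreconnected_image_coe (ordConnected_Ioi (a := a)), mem.2 (sub_neg.1 h1),
      mem.2 (sub_neg.1 h2), by simp, by simp⟩

theorem exists_isPreconnected_infty {a b y : ℝ} (h : 0 < (a - y) * (b - y)) :
    ∃ P : Set (OnePoint ℝ), IsPreconnected P ∧ ↑y ∈ P ∧ (∞ : OnePoint ℝ) ∈ P ∧ ↑a ∉ P ∧ ↑b ∉ P := by
  rcases pos_and_pos_or_neg_and_neg_of_mul_pos h with ⟨h1, h2⟩ | ⟨h1, h2⟩
  · exact ⟨_, isPreconnected_insert_infty_Iic y, by simp, by simp, by simp; linarith,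
      by simp; linarith⟩
  · exact ⟨_, isPreconnected_insert_infty_Ici y, by simp, by simp, by simp; linarith,
      by simp; linarith⟩

/-- Two points of the projective line that are not separated by two other points lie in a
connected set avoiding these. -/
theorem exists_isPreconnected {x y z u : OnePoint ℝ} (hxz : x ≠ z)
    (h : bracket x y * bracket z u * (bracket x u * bracket y z) < 0) :
    ∃ P : Set (OnePoint ℝ), IsPreconnected P ∧ y ∈ P ∧ u ∈ P ∧ x ∉ P ∧ z ∉ P := by
  induction x using OnePoint.rec with
  | infty =>
    induction z using OnePoint.rec with
    | infty => exact absurd rfl hxz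
    | coe z =>
      induction y using OnePoint.rec with
      | infty => simp at h
      | coe y =>
        induction u using OnePoint.rec with
        | infty => simp at h
        | coe u =>
          simp only [bracket_coe, bracket_infty_coe] at h
          obtain ⟨P, h1, h2, h3, h4, h5⟩ :=
            exists_isPreconnected_coe (a := z) (y := y) (u := u) (by linarith)
          exact ⟨P, h1, h2, h3, h5, h4⟩
  | coe x =>
    induction z using OnePoint.rec with
    | infty =>
      induction y using OnePoint.rec with
      | infty => simp at h
      | coe y =>
        induction u using OnePoint.rec with
        | infty => simp at h
        | coe u =>
          simp only [bracket_coe, bracket_infty_coe, bracket_coe_infty] at h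
          exact exists_isPreconnected_coe (a := x) (y := y) (u := u) (by linarith)
    | coe z =>
      have hxz' : x ≠ z := fun h => hxz (congrArg _ h)
      induction y using OnePoint.rec with
      | infty =>
        induction u using OnePoint.rec with
        | infty => exact ⟨{(∞ : OnePoint ℝ)}, isPreconnected_singleton, rfl, rfl, by simp, by simp⟩
        | coe u =>
          simp only [bracket_coe, bracket_infty_coe, bracket_coe_infty] at h
          obtain ⟨P, h1, h2, h3, h4⟩ :=
            exists_isPreconnected_infty (a := x) (b := z) (y := u) (by linarith)
          exact ⟨P, h1, h3, h2, h4⟩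
      | coe y =>
        induction u using OnePoint.rec with
        | infty =>
          simp only [bracket_coe, bracket_coe_infty] at h
          exact exists_isPreconnected_infty (a := x) (b := z) (y := y) (by linarith)
        | coe u =>
          simp only [bracket_coe] at h
          rcases hxz'.lt_or_gt with hlt | hlt
          · exact exists_isPreconnected_of_lt hlt (by linarith)
          · obtain ⟨P, h1, h2, h3, h4, h5⟩ :=
              exists_isPreconnected_of_lt (y := y) (u := u) hlt (by linarith)
            exact ⟨P, h1, h2, h3, h5, h4⟩

end Separation

section Charts

open Filter Topology Set

theorem ProjEq.trans {v w u : ℝ × ℝ × ℝ} (h1 : ProjEq v w) (h2 : ProjEq w u) : ProjEq v u :=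
  h1.symm.trans' h2

theorem ProjEq.eq_add_iff {v w : ℝ × ℝ × ℝ} (h : ProjEq v w) :
    v.2.1 = v.1 + v.2.2 ↔ w.2.1 = w.1 + w.2.2 := by
  obtain ⟨l, hl, rfl⟩ := h
  change v.2.1 = v.1 + v.2.2 ↔ l * v.2.1 = l * v.1 + l * v.2.2
  rw [← mul_add]
  exact (mul_right_inj' hl.ne').symm

theorem Admissible.of_ne {X : Type*} {x y z u : X} (hxy : x ≠ y) (hzu : z ≠ u) :
    Admissible x y z u :=
  ⟨fun h => hxy h.1, fun h => hxy h.1, fun h => hzu h.2, fun h => hzu h.2⟩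

theorem Admissible.map {X Z : Type*} {f : X → Z} (hf : Function.Injective f) {x y z u : X}
    (h : Admissible x y z u) : Admissible (f x) (f y) (f z) (f u) := by
  simpa only [Admissible, hf.eq_iff] using h

variable {X Y : Type*} [MetricSpace Y] {S : MobiusStructure X} {d e : ExtMetric X} {ω : X}
  {i : Y → X}

/-- The pullback of an extended metric by an involution. -/
def ExtMetric.comap (e : ExtMetric X) (φ : X → X) (hφ : Function.Involutive φ) : ExtMetric X where
  d x y := e.d (φ x) (φ y)
  rem := e.rem.map φ
  symm _ _ := e.symm _ _
  d_self _ := e.d_self _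
  pos _ _ h := e.pos _ _ (hφ.injective.ne h)
  triangle _ _ _ := e.triangle _ _ _
  d_eq_top_iff x y := by
    have h : ∀ x, e.rem.map φ = some x ↔ e.rem = some (φ x) := fun x => by
      cases e.rem with
      | none => simp
      | some a => simp [hφ.eq_iff]
    rw [e.d_eq_top_iff, h, h, hφ.injective.ne_iff]

theorem ExtMetric.comap_mem (he : e ∈ S.M) {φ : X → X} (hφ : Function.Involutive φ)
    (hauto : IsMobiusAuto S φ) : e.comap φ hφ ∈ S.M :=
  S.maximal _ fun d hd x y z u ha =>
    (hauto.2 d hd x y z u ha).trans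
      (S.compat d hd e he _ _ _ _ (ha.map hφ.injective))

theorem ExtMetric.fd_of_ne_top {x y : X} (h : e.d x y ≠ ⊤) : e.fd x y = (e.d x y).toReal :=
  if_neg h

theorem ExtMetric.mul_eq_add_of_crtVec {x y z u : X} (hxy : x ≠ y) (hxz : x ≠ z)
    (hyu : y ≠ u) (hzu : z ≠ u)
    (h : (crtVec e x y z u).2.1 = (crtVec e x y z u).1 + (crtVec e x y z u).2.2) :
    e.d x z * e.d y u = e.d x y * e.d z u + e.d x u * e.d y z := by
  have pos : ∀ {a b : X}, a ≠ b → e.d a b ≠ 0 := fun hab => (e.pos _ _ hab).ne'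
  by_cases hx : e.rem = some x
  · rw [(e.d_eq_top_iff x z).2 ⟨hxz, .inl hx⟩, (e.d_eq_top_iff x y).2 ⟨hxy, .inl hx⟩,
      ENNReal.top_mul (pos hyu), ENNReal.top_mul (pos hzu), top_add]
  by_cases hy : e.rem = some y
  · rw [(e.d_eq_top_iff y u).2 ⟨hyu, .inl hy⟩, (e.d_eq_top_iff x y).2 ⟨hxy, .inr hy⟩,
      ENNReal.mul_top (pos hxz), ENNReal.top_mul (pos hzu), top_add]
  by_cases hz : e.rem = some z
  · rw [(e.d_eq_top_iff x z).2 ⟨hxz, .inr hz⟩, (e.d_eq_top_iff z u).2 ⟨hzu, .inl hz⟩,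
      ENNReal.mul_top (pos hxy), ENNReal.top_mul (pos hyu), top_add]
  by_cases hu : e.rem = some u
  · rw [(e.d_eq_top_iff y u).2 ⟨hyu, .inr hu⟩, (e.d_eq_top_iff z u).2 ⟨hzu, .inr hu⟩,
      ENNReal.mul_top (pos hxy), ENNReal.mul_top (pos hxz), top_add]
  have fin : ∀ {a b : X}, ¬ e.rem = some a → ¬ e.rem = some b → e.d a b ≠ ⊤ :=
    fun {a b} ha hb hab => ((e.d_eq_top_iff a b).1 hab).2.elim ha hb
  have h1 := ENNReal.mul_ne_top (fin hx hz) (fin hy hu)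
  have h2 := ENNReal.mul_ne_top (fin hx hy) (fin hz hu)
  have h3 := ENNReal.mul_ne_top (fin hx hu) (fin hy hz)
  rw [← ENNReal.toReal_eq_toReal_iff' h1 (ENNReal.add_ne_top.2 ⟨h2, h3⟩), ENNReal.toReal_add h2 h3,
    ENNReal.toReal_mul, ENNReal.toReal_mul, ENNReal.toReal_mul]
  simpa only [crtVec, e.fd_of_ne_top (fin hx hz), e.fd_of_ne_top (fin hy hu),
    e.fd_of_ne_top (fin hx hy), e.fd_of_ne_top (fin hz hu), e.fd_of_ne_top (fin hx hu),
    e.fd_of_ne_top (fin hy hz)] using h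

theorem ExtMetric.crtVec_of_mul_eq_add {x y z u : X} (hx : e.rem ≠ some x) (hy : e.rem ≠ some y)
    (hz : e.rem ≠ some z) (hu : e.rem ≠ some u)
    (h : e.d x z * e.d y u = e.d x y * e.d z u + e.d x u * e.d y z) :
    (crtVec e x y z u).2.1 = (crtVec e x y z u).1 + (crtVec e x y z u).2.2 := by
  have fin : ∀ {a b : X}, ¬ e.rem = some a → ¬ e.rem = some b → e.d a b ≠ ⊤ :=
    fun {a b} ha hb hab => ((e.d_eq_top_iff a b).1 hab).2.elim ha hb
  have h2 := ENNReal.mul_ne_top (fin hx hy) (fin hz hu)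
  have h3 := ENNReal.mul_ne_top (fin hx hu) (fin hy hz)
  have h4 := congrArg ENNReal.toReal h
  rw [ENNReal.toReal_add h2 h3, ENNReal.toReal_mul, ENNReal.toReal_mul, ENNReal.toReal_mul] at h4
  simpa only [crtVec, e.fd_of_ne_top (fin hx hz), e.fd_of_ne_top (fin hy hu),
    e.fd_of_ne_top (fin hx hy), e.fd_of_ne_top (fin hz hu), e.fd_of_ne_top (fin hx hu),
    e.fd_of_ne_top (fin hy hz)] using h4

/-- The metric space `Y` is identified by `i` with the complement of the infinitely remote point
`ω` of a metric `d` of the Möbius structure. -/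
structure IsChart (S : MobiusStructure X) (d : ExtMetric X) (ω : X) (i : Y → X) : Prop where
  mem : d ∈ S.M
  rem_eq : d.rem = some ω
  injective : Function.Injective i
  range_eq : range i = {ω}ᶜ
  d_eq : ∀ a b, d.d (i a) (i b) = ENNReal.ofReal (dist a b)

namespace IsChart

theorem apply_ne (h : IsChart S d ω i) (a : Y) : i a ≠ ω := by
  have : i a ∈ range i := mem_range_self a
  rwa [h.range_eq] at this

theorem exists_apply_eq (h : IsChart S d ω i) {x : X} (hx : x ≠ ω) : ∃ a, i a = x := by
  have : x ∈ range i := by rwa [h.range_eq]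
  exact this

theorem d_infty (h : IsChart S d ω i) (a : Y) : d.d (i a) ω = ⊤ :=
  (d.d_eq_top_iff _ _).2 ⟨h.apply_ne a, .inr h.rem_eq⟩

theorem infty_d (h : IsChart S d ω i) (a : Y) : d.d ω (i a) = ⊤ := by
  rw [d.symm, h.d_infty]

theorem fd_coe (h : IsChart S d ω i) (a b : Y) : d.fd (i a) (i b) = dist a b := by
  rw [ExtMetric.fd, h.d_eq, if_neg ENNReal.ofReal_ne_top, ENNReal.toReal_ofReal dist_nonneg]

theorem fd_infty (h : IsChart S d ω i) (a : Y) : d.fd (i a) ω = 1 :=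
  if_pos (h.d_infty a)

theorem infty_fd (h : IsChart S d ω i) (a : Y) : d.fd ω (i a) = 1 :=
  if_pos (h.infty_d a)

theorem ptolemyInequality (h : IsChart S d ω i) (hpt : IsPtolemyStructure S) :
    PtolemyInequality Y := by
  intro x y z u
  by_cases ha : Admissible x y z u
  · have := (hpt d h.mem _ _ _ _ (ha.map h.injective)).2.1
    simpa only [crtVec, h.fd_coe] using this
  · by_contra hlt
    refine ha ⟨?_, ?_, ?_, ?_⟩ <;>
    · rintro ⟨rfl, rfl⟩
      exact hlt (by simp)

theorem isOpen_image_ball (h : IsChart S d ω i) [τ : TopologicalSpace X] (hτ : τ = mobiusTop S)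
    (y : Y) {r : ℝ} (hr : 0 < r) : IsOpen (i '' Metric.ball y r) := by
  subst hτ
  refine TopologicalSpace.isOpen_generateFrom_of_mem ⟨d, h.mem, i y, ?_, ENNReal.ofReal r,
    ENNReal.ofReal_pos.2 hr, ENNReal.ofReal_ne_top, .inl ?_⟩
  · rw [h.rem_eq]
    exact fun hy => h.apply_ne y (Option.some.inj hy).symm
  · ext x
    by_cases hx : x = ω
    · subst hx
      simp only [mem_ofPred_eq, h.infty_d, not_top_lt, iff_false]
      rintro ⟨a, -, ha⟩
      exact h.apply_ne a ha
    · obtain ⟨a, rfl⟩ := h.exists_apply_eq hx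
      rw [h.injective.mem_set_image, Metric.mem_ball, mem_ofPred_eq, h.d_eq,
        ENNReal.ofReal_lt_ofReal_iff hr]

theorem isClosed_image_closedBall (h : IsChart S d ω i) [τ : TopologicalSpace X]
    (hτ : τ = mobiusTop S) (y : Y) {r : ℝ} (hr : 0 < r) :
    IsClosed (i '' Metric.closedBall y r) := by
  subst hτ
  rw [← @isOpen_compl_iff]
  refine TopologicalSpace.isOpen_generateFrom_of_mem ⟨d, h.mem, i y, ?_, ENNReal.ofReal r,
    ENNReal.ofReal_pos.2 hr, ENNReal.ofReal_ne_top, .inr ?_⟩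
  · rw [h.rem_eq]
    exact fun hy => h.apply_ne y (Option.some.inj hy).symm
  · ext x
    by_cases hx : x = ω
    · subst hx
      simp only [mem_ofPred_eq, h.infty_d, ENNReal.ofReal_lt_top, iff_true]
      rintro ⟨a, -, ha⟩
      exact h.apply_ne a ha
    · obtain ⟨a, rfl⟩ := h.exists_apply_eq hx
      rw [mem_compl_iff, h.injective.mem_set_image, Metric.mem_closedBall, mem_ofPred_eq, h.d_eq,
        ENNReal.ofReal_lt_ofReal_iff_of_nonneg hr.le, not_le]

theorem t2Space (h : IsChart S d ω i) [τ : TopologicalSpace X] (hτ : τ = mobiusTop S) :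
    T2Space X :=
  t2Space_of_balls h.range_eq h.injective (fun y _ hr => h.isOpen_image_ball hτ y hr)
    (fun y _ hr => h.isClosed_image_closedBall hτ y hr)

theorem isOpenEmbedding (h : IsChart S d ω i) [τ : TopologicalSpace X] [CompactSpace X]
    (hτ : τ = mobiusTop S) : IsOpenEmbedding i ∧ ProperSpace Y :=
  isOpenEmbedding_of_balls h.injective (fun y _ hr => h.isOpen_image_ball hτ y hr)
    (fun y _ hr => h.isClosed_image_closedBall hτ y hr)

theorem exists_isChart [Nonempty Y] (h : IsChart S d ω i) (hI : PropertyI S) (w : X) :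
    ∃ (e : ExtMetric X) (j : Y → X), IsChart S e w j := by
  by_cases hw : w = ω
  · exact ⟨d, i, hw ▸ h⟩
  obtain ⟨φ, ⟨hauto, hinv, -, hφ, -⟩, -⟩ := hI w ω hw {x | d.d x w = 1}
    ⟨d, h.mem, h.rem_eq, 1, one_pos, ENNReal.one_ne_top, rfl⟩
  have hφ' : φ ω = w := by rw [← hφ, hinv]
  refine ⟨d.comap φ hinv, φ ∘ i, ExtMetric.comap_mem h.mem hinv hauto, ?_,
    hinv.injective.comp h.injective, ?_, fun a b => ?_⟩
  · simp [ExtMetric.comap, h.rem_eq, hφ']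
  · rw [range_comp, h.range_eq, image_compl_eq hinv.bijective, image_singleton, hφ']
  · simp only [ExtMetric.comap, Function.comp_apply, hinv _]
    exact h.d_eq a b

end IsChart

end Charts

section ChartCircles

open Filter Topology Set OnePoint

/-- A curve extended by the point at infinity. -/
def extend {X Y : Type*} (ω : X) (i : Y → X) (c : ℝ → Y) : OnePoint ℝ → X :=
  fun p => p.elim ω (fun t => i (c t))

theorem range_extend {X Y : Type*} (ω : X) (i : Y → X) (c : ℝ → Y) :
    range (extend ω i c) = insert ω (range fun t => i (c t)) := by
  ext x
  constructor
  · rintro ⟨p, rfl⟩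
    induction p using OnePoint.rec with
    | infty => exact .inl rfl
    | coe t => exact .inr ⟨t, rfl⟩
  · rintro (rfl | ⟨t, rfl⟩)
    · exact ⟨∞, rfl⟩
    · exact ⟨t, rfl⟩

variable {X Y : Type*} [MetricSpace Y] {S : MobiusStructure X} {d e : ExtMetric X} {ω : X}
  {i : Y → X}

namespace IsChart

theorem tendsto_cocompact (h : IsChart S d ω i) [τ : TopologicalSpace X] [CompactSpace X]
    (hτ : τ = mobiusTop S) : Tendsto i (cocompact Y) (𝓝 ω) := by
  intro U hU
  obtain ⟨V, hVU, hV, hω⟩ := mem_nhds_iff.1 hU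
  refine mem_of_superset (mem_cocompact.2 ⟨i ⁻¹' Vᶜ, ?_, ?_⟩) (preimage_mono hVU)
  · rw [(h.isOpenEmbedding hτ).1.isInducing.isCompact_preimage_iff]
    · exact hV.isClosed_compl.isCompact
    · rw [h.range_eq, compl_subset_compl, singleton_subset_iff]
      exact hω
  · rw [preimage_compl, compl_compl]
    exact Subset.rfl

theorem tendsto_dist (h : IsChart S d ω i) [τ : TopologicalSpace X]
    (hτ : τ = mobiusTop S) (o : Y) {ι : Type*} {l : Filter ι} {g : ι → Y}
    (hg : Tendsto (fun t => i (g t)) l (𝓝 ω)) : Tendsto (fun t => dist (g t) o) l atTop := by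
  refine tendsto_atTop.2 fun R => ?_
  have hmem : (i '' Metric.closedBall o (|R| + 1))ᶜ ∈ 𝓝 ω := by
    refine (h.isClosed_image_closedBall hτ o (by positivity)).isOpen_compl.mem_nhds ?_
    rintro ⟨a, -, ha⟩
    exact h.apply_ne a ha
  filter_upwards [hg hmem] with t ht
  by_contra hlt
  refine ht (mem_image_of_mem i (Metric.mem_closedBall.2 ?_))
  linarith [le_abs_self R]

theorem fd_extend (h : IsChart S d ω i) {c : ℝ → Y} (hc : Isometry c) (p q : OnePoint ℝ) :
    d.fd (extend ω i c p) (extend ω i c q) = |bracket p q| := by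
  induction p using OnePoint.rec with
  | infty =>
    induction q using OnePoint.rec with
    | infty => simp [extend, ExtMetric.fd, d.d_self]
    | coe t => simp [extend, h.infty_fd]
  | coe s =>
    induction q using OnePoint.rec with
    | infty => simp [extend, h.fd_infty]
    | coe t => simp [extend, h.fd_coe, hc.dist_eq, Real.dist_eq]

theorem injective_extend (h : IsChart S d ω i) {c : ℝ → Y} (hc : Isometry c) :
    Function.Injective (extend ω i c) := by
  intro p q hpq
  induction p using OnePoint.rec with
  | infty =>
    induction q using OnePoint.rec with
    | infty => rfl
    | coe t => exact absurd hpq.symm (h.apply_ne _)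
  | coe s =>
    induction q using OnePoint.rec with
    | infty => exact absurd hpq (h.apply_ne _)
    | coe t => exact congrArg _ (hc.injective (h.injective hpq))

theorem continuous_extend (h : IsChart S d ω i) [τ : TopologicalSpace X] [CompactSpace X]
    (hτ : τ = mobiusTop S) {c : ℝ → Y} (hc : Isometry c) : Continuous (extend ω i c) := by
  rw [OnePoint.continuous_iff]
  refine ⟨?_, (h.isOpenEmbedding hτ).1.continuous.comp hc.continuous⟩
  rw [coclosedCompact_eq_cocompact]
  exact (h.tendsto_cocompact hτ).comp hc.isClosedEmbedding.tendsto_cocompact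

/-- Isometrically embedded lines extend to Ptolemy circles. -/
theorem isPtolemyCircle (h : IsChart S d ω i) (hcomp : MobiusCompact S) {c : ℝ → Y}
    (hc : Isometry c) : IsPtolemyCircle S (insert ω (range fun t => i (c t))) := by
  let τ : TopologicalSpace X := mobiusTop S
  have hX : CompactSpace X := hcomp
  have hT : T2Space X := h.t2Space rfl
  have hκ := h.continuous_extend rfl hc
  have hinj := h.injective_extend hc
  rw [← range_extend]
  refine ⟨homeomorph_circle_of_param hκ hinj, ?_⟩
  rintro e he _ ⟨x, rfl⟩ _ ⟨y, rfl⟩ _ ⟨z, rfl⟩ _ ⟨u, rfl⟩ hxy hxz hxu hyz hyu hzu hsep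
  refine ExtMetric.mul_eq_add_of_crtVec hxy hxz hyu hzu ?_
  rw [← (S.compat d h.mem e he _ _ _ _ (.of_ne hxy hzu)).eq_add_iff]
  simp only [crtVec, h.fd_extend hc]
  refine abs_bracket_mul_eq_add (not_lt.1 fun hlt => hsep ?_)
  obtain ⟨P, hP, h1, h2, h3, h4⟩ := exists_isPreconnected (fun h => hxz (congrArg _ h)) hlt
  exact mem_connectedComponentIn_of_param hκ hinj hP h1 h2 h3 h4

end IsChart

/-- A curve along which distances are additive and unbounded in both directions has an arc
length parameterization. -/
theorem exists_isometry_of_dist_add {g : ℝ → Y} (hg : Continuous g)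
    (hadd : ∀ s t u, s < t → t < u → dist (g s) (g u) = dist (g s) (g t) + dist (g t) (g u))
    (htop : Tendsto (fun t => dist (g t) (g 0)) (cocompact ℝ) atTop) :
    ∃ c : ℝ → Y, Isometry c := by
  have hadd' : ∀ s t u, s ≤ t → t ≤ u →
      dist (g s) (g u) = dist (g s) (g t) + dist (g t) (g u) := by
    intro s t u hst htu
    rcases hst.eq_or_lt with rfl | hst
    · simp
    rcases htu.eq_or_lt with rfl | htu
    · simp
    exact hadd s t u hst htu
  let F : ℝ → ℝ := fun t => if 0 ≤ t then dist (g t) (g 0) else -dist (g t) (g 0)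
  have hF0 : ∀ t, 0 ≤ t → F t = dist (g t) (g 0) := fun t ht => if_pos ht
  have hF1 : ∀ t, t < 0 → F t = -dist (g t) (g 0) := fun t ht => if_neg (not_le.2 ht)
  have hFle : ∀ s t, s ≤ t → F t - F s = dist (g s) (g t) := by
    intro s t hst
    rcases le_or_gt 0 s with hs | hs
    · rw [hF0 s hs, hF0 t (hs.trans hst)]
      have := hadd' 0 s t hs hst
      rw [dist_comm (g t), dist_comm (g s) (g 0)]
      linarith
    · rcases le_or_gt 0 t with ht | ht
      · rw [hF1 s hs, hF0 t ht, dist_comm (g t)]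
        linarith [hadd' s 0 t hs.le ht]
      · rw [hF1 s hs, hF1 t ht]
        linarith [hadd' s t 0 hst ht.le]
  have hF : ∀ s t, dist (F s) (F t) = dist (g s) (g t) := by
    intro s t
    rcases le_total s t with hst | hst
    · rw [dist_comm, Real.dist_eq, hFle s t hst, abs_of_nonneg dist_nonneg]
    · rw [Real.dist_eq, hFle t s hst, abs_of_nonneg dist_nonneg, dist_comm]
  have hFc : Continuous F := by
    rw [Metric.continuous_iff] at hg ⊢
    simpa only [hF] using hg
  have hFtop : Tendsto F atTop atTop := by
    refine (htop.mono_left atTop_le_cocompact).congr' ?_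
    filter_upwards [eventually_ge_atTop 0] with t ht
    exact (hF0 t ht).symm
  have hFbot : Tendsto F atBot atBot := by
    refine (tendsto_neg_atTop_atBot.comp (htop.mono_left atBot_le_cocompact)).congr' ?_
    filter_upwards [eventually_lt_atBot 0] with t ht
    exact (hF1 t ht).symm
  have hsurj := hFc.surjective hFtop hFbot
  refine ⟨g ∘ Function.surjInv hsurj, Isometry.of_dist_eq fun a b => ?_⟩
  rw [Function.comp_apply, Function.comp_apply, ← hF, Function.surjInv_eq hsurj,
    Function.surjInv_eq hsurj]

namespace IsChart

/-- A Ptolemy circle through the infinitely remote point is an isometrically embedded line. -/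
theorem exists_isometry_of_isPtolemyCircle (h : IsChart S d ω i) (hcomp : MobiusCompact S)
    (hI : PropertyI S) {σ : Set X} (hσ : IsPtolemyCircle S σ) (hω : ω ∈ σ) :
    ∃ c : ℝ → Y, Isometry c := by
  let τ : TopologicalSpace X := mobiusTop S
  have hX : CompactSpace X := hcomp
  have hT : T2Space X := h.t2Space rfl
  obtain ⟨κ, hκ, hinj, rfl, rfl⟩ := exists_onePoint_param hσ.1 hω
  have hne : ∀ t : ℝ, κ t ≠ κ ∞ := fun t => hinj.ne (coe_ne_infty t)
  choose g hg using fun t => h.exists_apply_eq (hne t)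
  have hY : Nonempty Y := ⟨g 0⟩
  have hcont := OnePoint.continuous_iff κ |>.1 hκ
  have hi := (h.isOpenEmbedding rfl).1
  refine exists_isometry_of_dist_add (g := g) ?_ ?_ ?_
  · rw [hi.isInducing.continuous_iff]
    exact hcont.2.congr fun t => (hg t).symm
  · intro s t u hst htu
    obtain ⟨e, j, he⟩ := h.exists_isChart hI (κ ↑(u + 1))
    have hinj' : ∀ {a b : ℝ}, a ≠ b → κ a ≠ κ b := fun hab => hinj.ne (coe_injective.ne hab)
    have hrem : ∀ {p : OnePoint ℝ}, p ≠ ↑(u + 1) → e.rem ≠ Option.some (κ p) := fun hp hp' => by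
      rw [he.rem_eq] at hp'
      exact hp (hinj (Option.some.inj hp')).symm
    have hsep : SeparatesIn S (range κ) (κ s) (κ u) (κ t) (κ (∞ : OnePoint ℝ)) :=
      infty_notMem_connectedComponentIn hκ hinj hst htu
    have key := hσ.2 e he.mem _ (mem_range_self _) _ (mem_range_self _) _ (mem_range_self _) _
      (mem_range_self _) (hinj' hst.ne) (hinj' (hst.trans htu).ne) (hne s) (hinj' htu.ne) (hne t)
      (hne u) hsep
    have hu : ∀ {a : ℝ}, a < u + 1 → (a : OnePoint ℝ) ≠ ↑(u + 1) :=
      fun ha => coe_injective.ne ha.ne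
    have key' := ExtMetric.crtVec_of_mul_eq_add (hrem (hu (by linarith))) (hrem (hu (by linarith)))
      (hrem (hu (by linarith))) (hrem (infty_ne_coe _)) key
    rw [(S.compat e he.mem d h.mem _ _ _ _ (.of_ne (hinj' hst.ne) (hne u))).eq_add_iff] at key'
    simpa only [crtVec, ← hg, h.fd_coe, h.fd_infty, mul_one, one_mul] using key'
  · refine h.tendsto_dist rfl (g 0) ?_
    rw [← coclosedCompact_eq_cocompact]
    simpa only [hg] using hcont.1

theorem exists_isometry [Nonempty Y] (h : IsChart S d ω i) (hcomp : MobiusCompact S)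
    (hI : PropertyI S) (hE : PropertyE S) : ∃ c : ℝ → Y, Isometry c := by
  let τ : TopologicalSpace X := mobiusTop S
  obtain ⟨σ, hσ⟩ := hE
  obtain ⟨f⟩ : Nonempty (σ ≃ₜ Metric.sphere (0 : ℂ) 1) := hσ.1
  obtain ⟨e, j, he⟩ := h.exists_isChart hI (f.symm ⟨1, by simp⟩ : X)
  exact he.exists_isometry_of_isPtolemyCircle hcomp hI hσ (Subtype.coe_prop _)

end IsChart

end ChartCircles

section SpaceInversions

open Filter Topology Set

variable {X Y : Type*} [MetricSpace Y] {S : MobiusStructure X} {d : ExtMetric X} {ω : X}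
  {i : Y → X}

namespace IsChart

theorem exists_lift (h : IsChart S d ω i) {o : Y} {φ : X → X} (hinv : Function.Involutive φ)
    (hφ : φ (i o) = ω) : ∃ ψ : Y → Y, ∀ x, x ≠ o → i (ψ x) = φ (i x) := by
  have : ∀ x, ∃ y, x ≠ o → i y = φ (i x) := by
    intro x
    by_cases hx : x = o
    · exact ⟨o, fun h => absurd hx h⟩
    · have hne : φ (i x) ≠ ω := fun h' => hx (h.injective (hinv.injective (h'.trans hφ.symm)))
      obtain ⟨y, hy⟩ := h.exists_apply_eq hne
      exact ⟨y, fun _ => hy⟩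
  choose ψ hψ using this
  exact ⟨ψ, hψ⟩

/-- A Möbius involution exchanging the infinitely remote point with `o` acts on distances like the
inversion in some sphere centered at `o`. -/
theorem exists_radius [Nontrivial Y] (h : IsChart S d ω i) {o : Y} {φ : X → X}
    (hauto : IsMobiusAuto S φ) (hinv : Function.Involutive φ) (hφ : φ (i o) = ω) {ψ : Y → Y}
    (hψ : ∀ x, x ≠ o → i (ψ x) = φ (i x)) :
    ∃ ρ : ℝ, 0 < ρ ∧ (∀ x, x ≠ o → dist (ψ x) o = ρ / dist x o) ∧
      ∀ x y, x ≠ o → y ≠ o → dist (ψ x) (ψ y) = ρ * dist x y / (dist x o * dist y o) := by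
  have hφ' : φ ω = i o := by rw [← hφ, hinv]
  have hlam : ∀ x y, x ≠ o → y ≠ o → ∃ lam : ℝ, dist (ψ x) (ψ y) = lam * dist x y ∧
      dist (ψ y) o = lam * dist x o ∧ dist (ψ x) o = lam * dist y o := by
    intro x y hx hy
    obtain ⟨lam, -, hlam⟩ := hauto.2 d h.mem (i x) (i y) (i o) ω
      ⟨fun h' => hy (h.injective h'.2), fun h' => h.apply_ne y h'.2, fun h' => h.apply_ne o h'.2,
        fun h' => h.apply_ne o h'.2⟩
    have h1 := congrArg Prod.fst hlam
    have h2 := congrArg (fun v => v.2.1) hlam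
    have h3 := congrArg (fun v => v.2.2) hlam
    simp only [crtVec, Prod.smul_mk, smul_eq_mul, hφ, hφ', ← hψ x hx, ← hψ y hy, h.fd_coe,
      h.fd_infty, h.infty_fd, mul_one, one_mul] at h1 h2 h3
    exact ⟨lam, h1, h2, h3⟩
  obtain ⟨x₀, hx₀⟩ := exists_ne o
  have hψo : dist (ψ x₀) o ≠ 0 := by
    intro h0
    have h1 := hψ x₀ hx₀
    rw [dist_eq_zero.1 h0, ← hφ'] at h1
    exact h.apply_ne x₀ (hinv.injective h1).symm
  have hx₀' : 0 < dist x₀ o := dist_pos.2 hx₀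
  have hρ : ∀ x, x ≠ o → dist (ψ x) o = dist (ψ x₀) o * dist x₀ o / dist x o := by
    intro x hx
    obtain ⟨lam, -, h2, h3⟩ := hlam x x₀ hx hx₀
    rw [eq_div_iff (dist_pos.2 hx).ne', h2, h3]
    ring
  refine ⟨dist (ψ x₀) o * dist x₀ o, mul_pos (lt_of_le_of_ne dist_nonneg hψo.symm) hx₀', hρ, ?_⟩
  intro x y hx hy
  obtain ⟨lam, h1, -, h3⟩ := hlam x y hx hy
  have hx' := (dist_pos.2 hx).ne'
  have hy' := (dist_pos.2 hy).ne'
  rw [hρ x hx, div_eq_iff hx'] at h3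
  rw [h1, h3]
  field_simp

theorem isMetricSphere (h : IsChart S d ω i) (o : Y) {r : ℝ} (hr : 0 < r) :
    IsMetricSphere S (i o) ω {x | d.d x (i o) = ENNReal.ofReal r} :=
  ⟨d, h.mem, h.rem_eq, _, ENNReal.ofReal_pos.2 hr, ENNReal.ofReal_ne_top, rfl⟩

theorem mem_sphere (h : IsChart S d ω i) {o x : Y} {r : ℝ} (hr : 0 < r) :
    d.d (i x) (i o) = ENNReal.ofReal r ↔ dist x o = r := by
  rw [h.d_eq, ENNReal.ofReal_eq_ofReal_iff dist_nonneg hr.le]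

theorem radius_eq (h : IsChart S d ω i) {o : Y} {φ : X → X} {ψ : Y → Y}
    (hψ : ∀ x, x ≠ o → i (ψ x) = φ (i x)) {ρ r : ℝ} (hr : 0 < r)
    (hρ : ∀ x, x ≠ o → dist (ψ x) o = ρ / dist x o)
    (himage : φ '' {x | d.d x (i o) = ENNReal.ofReal r} = {x | d.d x (i o) = ENNReal.ofReal r})
    {y : Y} (hy : dist y o = r) : ρ = r ^ 2 := by
  have hyo : y ≠ o := dist_pos.1 (hy ▸ hr)
  have hmem : φ (i y) ∈ {x | d.d x (i o) = ENNReal.ofReal r} := by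
    rw [← himage]
    exact mem_image_of_mem φ ((h.mem_sphere hr).2 hy)
  rw [← hψ y hyo, mem_ofPred_eq, h.mem_sphere hr, hρ y hyo, hy, div_eq_iff hr.ne'] at hmem
  rw [hmem, sq]

/-- Metric spheres are nonempty. -/
theorem exists_dist_eq [Nontrivial Y] (h : IsChart S d ω i) (hI : PropertyI S) {c : ℝ → Y}
    (hc : Isometry c) (o : Y) {r : ℝ} (hr : 0 < r) : ∃ y, dist y o = r := by
  by_contra! hempty
  have hS : {x | d.d x (i o) = ENNReal.ofReal r} = ∅ := by
    rw [eq_empty_iff_forall_notMem]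
    intro x hx
    by_cases hxω : x = ω
    · rw [hxω, mem_ofPred_eq, h.infty_d] at hx
      exact ENNReal.ofReal_ne_top hx.symm
    · obtain ⟨y, rfl⟩ := h.exists_apply_eq hxω
      exact hempty y ((h.mem_sphere hr).1 hx)
  obtain ⟨φ, hφ, huniq⟩ := hI (i o) ω (h.apply_ne o) _ (h.isMetricSphere o hr)
  obtain ⟨ψ, hψ⟩ := h.exists_lift hφ.2.1 hφ.2.2.2.1
  obtain ⟨ρ, -, hρ, -⟩ := h.exists_radius hφ.1 hφ.2.1 hφ.2.2.2.1 hψ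
  have key : ∀ y, y ≠ o → ρ = dist y o ^ 2 := by
    intro y hy
    have hy' := dist_pos.2 hy
    obtain ⟨φ', hφ', -⟩ := hI (i o) ω (h.apply_ne o) _ (h.isMetricSphere o hy')
    have heq : φ' = φ := by
      refine huniq φ' ⟨hφ'.1, hφ'.2.1, hφ'.2.2.1, hφ'.2.2.2.1, ?_, hφ'.2.2.2.2.2⟩
      rw [hS, image_empty]
    exact h.radius_eq hψ hy' hρ (heq ▸ hφ'.2.2.2.2.1) rfl
  have hρ0 := Real.sqrt_nonneg ρ
  have h1 : √ρ + 1 ≤ dist (c (√ρ + 1 + dist (c 0) o)) o := by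
    have h2 := dist_triangle (c (√ρ + 1 + dist (c 0) o)) o (c 0)
    rw [hc.dist_eq, Real.dist_eq, sub_zero, abs_of_nonneg (by positivity), dist_comm o] at h2
    linarith
  have h3 := key _ (dist_pos.1 (lt_of_lt_of_le (by positivity) h1))
  have h4 := Real.sqrt_sq (dist_nonneg (x := c (√ρ + 1 + dist (c 0) o)) (y := o))
  rw [← h3] at h4
  linarith

theorem exists_isInversionAt [Nontrivial Y] (h : IsChart S d ω i) (hcomp : MobiusCompact S)
    (hI : PropertyI S) (hE : PropertyE S) (o : Y) {r : ℝ} (hr : 0 < r) :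
    ∃ ψ : Y → Y, IsInversionAt o r ψ := by
  obtain ⟨c₀, hc₀⟩ := h.exists_isometry hcomp hI hE
  obtain ⟨φ, ⟨hauto, hinv, hfix, hφ, himage, hcircle⟩, -⟩ :=
    hI (i o) ω (h.apply_ne o) _ (h.isMetricSphere o hr)
  obtain ⟨ψ, hψ⟩ := h.exists_lift hinv hφ
  obtain ⟨ρ, -, hρ, hρ'⟩ := h.exists_radius hauto hinv hφ hψ
  obtain ⟨y₀, hy₀⟩ := h.exists_dist_eq hI hc₀ o hr
  obtain rfl : ρ = r ^ 2 := h.radius_eq hψ hr hρ himage hy₀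
  refine ⟨ψ, hρ, hρ', fun c hc hc0 => ?_⟩
  have hne : ∀ t, t ≠ 0 → c t ≠ o := fun t ht ht' => ht (hc.injective (ht'.trans hc0.symm))
  have hdist : ∀ t, dist (c t) o = |t| := fun t => by
    rw [← hc0, hc.dist_eq, Real.dist_eq, sub_zero]
  have hline : ∀ t, t ≠ 0 → ψ (c t) = c (r ^ 2 / t) ∨ ψ (c t) = c (-r ^ 2 / t) := by
    intro t ht
    have himg := hcircle _ (h.isPtolemyCircle hcomp hc) (.inr ⟨0, congrArg i hc0⟩) (.inl rfl)
    have hmem : φ (i (c t)) ∈ insert ω (range fun t => i (c t)) := by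
      rw [← himg]
      exact mem_image_of_mem φ (.inr ⟨t, rfl⟩)
    rw [← hψ _ (hne t ht)] at hmem
    obtain hmem | ⟨u, hu⟩ := hmem
    · exact absurd hmem (h.apply_ne _)
    have hu' : c u = ψ (c t) := h.injective hu
    have h1 := hρ _ (hne t ht)
    rw [← hu', hdist, hdist, ← abs_of_pos (pow_pos hr 2), ← abs_div, abs_eq_abs] at h1
    rw [← hu', neg_div]
    rcases h1 with h1 | h1
    · exact .inl (congrArg c h1)
    · exact .inr (congrArg c h1)
  have hr' : ψ (c r) = c (-r) := by
    have h1 : r ^ 2 / r = r := by field_simp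
    have h2 := hline r hr.ne'
    rw [neg_div, h1] at h2
    refine h2.resolve_left fun h3 => hfix (i (c r)) ?_
    rw [← hψ _ (hne r hr.ne'), h3]
  intro t ht
  refine (hline t ht).resolve_left fun h1 => ?_
  have h2 := hρ' _ _ (hne t ht) (hne r hr.ne')
  rw [h1, hr', hc.dist_eq, hc.dist_eq, hdist, hdist, Real.dist_eq, Real.dist_eq] at h2
  have ht' : |t| ≠ 0 := abs_ne_zero.2 ht
  have h3 : |r + t| = |t - r| := by
    have h4 : r ^ 2 / t - -r = r * (r + t) / t := by
      field_simp
      ring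
    rw [h4, abs_div, abs_mul, abs_of_pos hr] at h2
    field_simp at h2
    exact h2
  rcases abs_eq_abs.1 h3 with h4 | h4
  · linarith
  · exact ht (by linarith)

end IsChart

end SpaceInversions

section Euclidean

open Filter Topology Set

theorem ExtMetric.d_ne_top {X : Type*} (d : ExtMetric X) {ω : X} (hrem : d.rem = some ω)
    (x y : {x : X // x ≠ ω}) : d.d x y ≠ ⊤ := fun h => by
  have := ((d.d_eq_top_iff _ _).1 h).2
  rw [hrem, Option.some.injEq, Option.some.injEq] at this
  exact this.elim (fun h => x.2 h.symm) (fun h => y.2 h.symm)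

/-- The complement of the infinitely remote point as a metric space. -/
noncomputable abbrev ExtMetric.toMetricSpace {X : Type*} (d : ExtMetric X) {ω : X}
    (hrem : d.rem = some ω) : MetricSpace {x : X // x ≠ ω} where
  dist x y := (d.d x y).toReal
  dist_self x := by simp [d.d_self]
  dist_comm x y := by rw [d.symm]
  dist_triangle x y z := by
    rw [← ENNReal.toReal_add (d.d_ne_top hrem x y) (d.d_ne_top hrem y z)]
    exact ENNReal.toReal_mono
      (ENNReal.add_ne_top.2 ⟨d.d_ne_top hrem x y, d.d_ne_top hrem y z⟩) (d.triangle _ _ _)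
  eq_of_dist_eq_zero := fun {x y} h => by
    by_contra hne
    have h1 := d.pos x y fun h => hne (Subtype.ext h)
    exact (ENNReal.toReal_pos h1.ne' (d.d_ne_top hrem x y)).ne' h

namespace IsChart

theorem mobiusEquiv {X X' Y : Type*} [MetricSpace Y] {S : MobiusStructure X}
    {S' : MobiusStructure X'} {d : ExtMetric X} {d' : ExtMetric X'} {ω : X} {ω' : X'} {i : Y → X}
    {i' : Y → X'} (h : IsChart S d ω i) (h' : IsChart S' d' ω' i') : MobiusEquiv S S' := by
  have hex : ∀ x, ∃ x', (x = ω → x' = ω') ∧ ∀ a, i a = x → x' = i' a := by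
    intro x
    by_cases hx : x = ω
    · exact ⟨ω', fun _ => rfl, fun a ha => absurd (ha.trans hx) (h.apply_ne a)⟩
    · obtain ⟨a, rfl⟩ := h.exists_apply_eq hx
      exact ⟨i' a, fun hx' => absurd hx' hx, fun b hb => by rw [h.injective hb]⟩
  choose f hf using hex
  have hω : f ω = ω' := (hf ω).1 rfl
  have hi : ∀ a, f (i a) = i' a := fun a => (hf _).2 a rfl
  have hinj : Function.Injective f := by
    intro x y hxy
    by_cases hx : x = ω <;> by_cases hy : y = ω
    · rw [hx, hy]
    · obtain ⟨b, rfl⟩ := h.exists_apply_eq hy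
      rw [hx, hω, hi] at hxy
      exact absurd hxy.symm (h'.apply_ne b)
    · obtain ⟨a, rfl⟩ := h.exists_apply_eq hx
      rw [hy, hω, hi] at hxy
      exact absurd hxy (h'.apply_ne a)
    · obtain ⟨a, rfl⟩ := h.exists_apply_eq hx
      obtain ⟨b, rfl⟩ := h.exists_apply_eq hy
      rw [hi, hi] at hxy
      rw [h'.injective hxy]
  have hsurj : Function.Surjective f := by
    intro x'
    by_cases hx : x' = ω'
    · exact ⟨ω, hω.trans hx.symm⟩
    · obtain ⟨a, rfl⟩ := h'.exists_apply_eq hx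
      exact ⟨i a, hi a⟩
  have hfd : ∀ x y, d'.fd (f x) (f y) = d.fd x y := by
    intro x y
    by_cases hx : x = ω <;> by_cases hy : y = ω
    · simp [hx, hy, ExtMetric.fd, ExtMetric.d_self]
    · obtain ⟨b, rfl⟩ := h.exists_apply_eq hy
      rw [hx, hω, hi, h'.infty_fd, h.infty_fd]
    · obtain ⟨a, rfl⟩ := h.exists_apply_eq hx
      rw [hy, hω, hi, h'.fd_infty, h.fd_infty]
    · obtain ⟨a, rfl⟩ := h.exists_apply_eq hx
      obtain ⟨b, rfl⟩ := h.exists_apply_eq hy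
      rw [hi, hi, h'.fd_coe, h.fd_coe]
  refine ⟨f, ⟨hinj, hsurj⟩, fun e he e' he' x y z u ha => ?_⟩
  refine (S.compat e he d h.mem x y z u ha).trans ?_
  have hcrt : crtVec d x y z u = crtVec d' (f x) (f y) (f z) (f u) := by
    simp only [crtVec, hfd]
  rw [hcrt]
  exact S'.compat d' h'.mem e' he' _ _ _ _ (ha.map hinj)

theorem ofMetric_stdExtMetric {Y : Type*} [MetricSpace Y] {n : ℕ}
    (f : Y ≃ᵢ EuclideanSpace ℝ (Fin n)) :
    IsChart (.ofMetric (stdExtMetric n)) (stdExtMetric n) none (fun a => some (f a)) where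
  mem := fun _ _ _ _ _ => ProjEq.refl _
  rem_eq := rfl
  injective := (Option.some_injective _).comp f.injective
  range_eq := by
    ext x
    cases x with
    | none => simp
    | some v => simpa using f.surjective v
  d_eq a b := by
    rw [← f.dist_eq]
    rfl

theorem exists_busemann_ne {X Y : Type*} [MetricSpace Y] {S : MobiusStructure X}
    {d : ExtMetric X} {ω : X} {i : Y → X} (h : IsChart S d ω i)
    (hfib : ∀ x : X, x ≠ ω → mobiusFiber S d ω x = {x}) {x y : Y} (hxy : x ≠ y) :
    ∃ c : ℝ → Y, Isometry c ∧ busemann c x ≠ busemann c y := by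
  by_contra! hB
  have hy : i y ∈ mobiusFiber S d ω (i x) := by
    refine ⟨h.apply_ne y, ?_⟩
    rintro l b ⟨⟨σ, -, -, rfl⟩, γ, ⟨hrange, hγ⟩, C, hlim⟩
    have hne : ∀ t, γ t ≠ ω := fun t => by
      have : γ t ∈ range γ := mem_range_self t
      rw [hrange] at this
      exact this.2
    choose c hc using fun t => h.exists_apply_eq (hne t)
    have hiso : Isometry c := Isometry.of_dist_eq fun s t => by
      have := hγ s t
      rw [← hc, ← hc, h.d_eq, ENNReal.ofReal_eq_ofReal_iff dist_nonneg (abs_nonneg _)] at this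
      exact this
    have hval : ∀ z, b (i z) + C = busemann c z := by
      intro z
      refine tendsto_nhds_unique (hlim _ (h.apply_ne z)) ?_
      refine (tendsto_busemann hiso z).congr fun t => ?_
      rw [← hc, h.d_eq, ENNReal.toReal_ofReal dist_nonneg]
    have := hB c hiso
    rw [← hval, ← hval] at this
    linarith
  rw [hfib _ (h.apply_ne x)] at hy
  exact hxy (h.injective hy).symm

theorem exists_isometryEquiv {X Y : Type*} [MetricSpace Y] [Nonempty Y] {S : MobiusStructure X}
    {d : ExtMetric X} {ω : X} {i : Y → X} (h : IsChart S d ω i) (hpt : IsPtolemyStructure S)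
    (hcomp : MobiusCompact S) (hE : PropertyE S) (hI : PropertyI S)
    (hfib : ∀ x : X, x ≠ ω → mobiusFiber S d ω x = {x}) :
    ∃ n, 1 ≤ n ∧ Nonempty (Y ≃ᵢ EuclideanSpace ℝ (Fin n)) := by
  let τ : TopologicalSpace X := mobiusTop S
  have hX : CompactSpace X := hcomp
  have hproper := (h.isOpenEmbedding rfl).2
  obtain ⟨c, hc⟩ := h.exists_isometry hcomp hI hE
  have hnt : Nontrivial Y := hc.injective.nontrivial
  exact exists_isometryEquiv_euclideanSpace (h.ptolemyInequality hpt)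
    (fun o _ hr => h.exists_isInversionAt hcomp hI hE o hr)
    (fun _ _ hxy => h.exists_busemann_ne hfib hxy)

end IsChart

theorem isChart_subtypeVal {X : Type*} {S : MobiusStructure X} {d : ExtMetric X} (hd : d ∈ S.M)
    {ω : X} (hrem : d.rem = some ω) :
    @IsChart X {x : X // x ≠ ω} (d.toMetricSpace hrem) S d ω Subtype.val :=
  @IsChart.mk X {x : X // x ≠ ω} (d.toMetricSpace hrem) S d ω Subtype.val hd hrem
    Subtype.val_injective Subtype.range_val
    fun a b => (ENNReal.ofReal_toReal (d.d_ne_top hrem a b)).symm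

/-- A Möbius space with a Ptolemy circle has at least two points. -/
theorem PropertyE.exists_ne {X : Type*} {S : MobiusStructure X} (hE : PropertyE S) (ω : X) :
    ∃ x, x ≠ ω := by
  let τ : TopologicalSpace X := mobiusTop S
  obtain ⟨σ, hσ⟩ := hE
  obtain ⟨f⟩ : Nonempty (σ ≃ₜ Metric.sphere (0 : ℂ) 1) := hσ.1
  by_contra! hX
  have h1 : f.symm ⟨1, by simp⟩ = f.symm ⟨-1, by simp⟩ :=
    Subtype.ext ((hX _).trans (hX _).symm)
  have h2 : (1 : ℂ) = -1 := congrArg Subtype.val (f.symm.injective h1)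
  norm_num at h2

end Euclidean

/-- the case `p = 0` of the main theorem; cf. Remark 4.5.  Let `X` be
a compact Ptolemy space with properties (E) and (I) such that for some `ω ∈ X` every
fiber of the canonical fibration `π_ω` is a single point.  Then there are `n ≥ 1` and a
metric `d' ∈ 𝓜` with infinitely remote point `ω` such that `(X∖{ω}, d')` is isometric
to the Euclidean space `ℝⁿ`; consequently `X` is Möbius equivalent to the standard
Möbius sphere `ℝ̂ⁿ = ℝⁿ ∪ {∞} = ∂_∞ H^{n+1}`. -/
theorem stmt_18 {X : Type*} (S : MobiusStructure X)
    (hpt : IsPtolemyStructure S) (hcomp : MobiusCompact S)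
    (hE : PropertyE S) (hI : PropertyI S)
    (ω : X) (d : ExtMetric X) (hd : d ∈ S.M) (hrem : d.rem = some ω)
    (hfib : ∀ x : X, x ≠ ω → mobiusFiber S d ω x = {x}) :
    ∃ n : ℕ, 1 ≤ n ∧
      (∃ d' ∈ S.M, d'.rem = some ω ∧
        ∃ f : {x : X // x ≠ ω} → EuclideanSpace ℝ (Fin n),
          Function.Bijective f ∧
          ∀ a b : {x : X // x ≠ ω}, dist (f a) (f b) = (d'.d a.1 b.1).toReal) ∧
      MobiusEquiv S (MobiusStructure.ofMetric (stdExtMetric n)) := by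
  let _ : MetricSpace {x : X // x ≠ ω} := d.toMetricSpace hrem
  have h : IsChart S d ω (Subtype.val : {x : X // x ≠ ω} → X) := isChart_subtypeVal hd hrem
  have hne : Nonempty {x : X // x ≠ ω} := nonempty_subtype.2 (hE.exists_ne ω)
  obtain ⟨n, hn, ⟨f⟩⟩ := h.exists_isometryEquiv hpt hcomp hE hI hfib
  exact ⟨n, hn, ⟨d, hd, hrem, f, f.bijective, f.dist_eq⟩,
    h.mobiusEquiv (IsChart.ofMetric_stdExtMetric f)⟩

end Mobius
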